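/- arXiv:0810.2452 — 2 statements merged into one kernel-verified Lean document; each statement's English description precedes it below -/
import Mathlib

section
/- Let (Ω, 𝒜, μ, T) be an aperiodic dynamical system on a standard Borel probability space and (aₙ) an increasing sequence of positive reals with aₙ → ∞ and aₙ/n → 0. Let ν be a zero-mean Borel probability measure on ℝ and let ε, ε′ > 0. Then there exist a measurable set A and positive integers n₁ < n₂ such that μ(A) ≤ ε, d(ℒ((1/a_{n₁}) S_{n₁}(1_A − μ(A))), ν) ≤ ε, and d(ℒ((1/a_{n₂}) S_{n₂}(1_A − μ(A))), δ₀) ≤ ε′, where d is the Lévy metric and δ₀ is the Dirac measure at 0. -/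
open MeasureTheory Filter Topology Set

/-- The Lévy metric between two Borel measures on `ℝ`, defined via their cumulative
distribution functions. -/
noncomputable def levyDist (μ ν : Measure ℝ) : ℝ :=
  sInf {ε : ℝ | 0 < ε ∧ ∀ t : ℝ,
    ProbabilityTheory.cdf ν (t - ε) - ε ≤ ProbabilityTheory.cdf μ t ∧
    ProbabilityTheory.cdf μ t ≤ ProbabilityTheory.cdf ν (t + ε) + ε}

/-- A countable measurable colouring of an aperiodic system in which points of the same orbit at
time distance at most `N` receive different colours. -/
theorem exists_measurable_nat_coloring {Ω : Type*} [MeasurableSpace Ω] [StandardBorelSpace Ω]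
    {μ : Measure Ω} {T : Ω → Ω} (hT : MeasurePreserving T μ μ)
    (haper : μ {x | ∃ n ≥ 1, T^[n] x = x} = 0) (N : ℕ) :
    ∃ m : Ω → ℕ, Measurable m ∧
      ∀ᵐ x ∂μ, ∀ i j, i < j → j ≤ i + N → m (T^[i] x) ≠ m (T^[j] x) := by
  classical
  have hTi : ∀ i, MeasurePreserving T^[i] μ μ := fun i => hT.iterate i
  set f := embeddingReal Ω
  have hf : MeasurableEmbedding f := measurableEmbedding_embeddingReal Ω
  have hb := TopologicalSpace.isBasis_countableBasis ℝ
  obtain ⟨U, hU⟩ := (TopologicalSpace.countable_countableBasis ℝ).exists_eq_range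
    (by
      obtain ⟨v, hv, -⟩ := hb.exists_subset_of_mem_open (mem_univ (0 : ℝ)) isOpen_univ
      exact ⟨v, hv⟩)
  have hUo : ∀ k, IsOpen (U k) := fun k => hb.isOpen (hU ▸ mem_range_self k)
  let V : ℕ → Set Ω := fun k =>
    {x | f x ∈ U k ∧ ∀ i ∈ Finset.Icc 1 N, f (T^[i] x) ∉ U k}
  have hV : ∀ k, MeasurableSet (V k) := by
    intro k
    simp only [V, ofPred_and, ofPred_forall]
    refine (hf.measurable (hUo k).measurableSet).inter ?_
    exact MeasurableSet.iInter fun i => MeasurableSet.iInter fun _ =>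
      ((hf.measurable.comp (hTi i).measurable) (hUo k).measurableSet).compl
  have hex : ∀ x, ∃ k, x ∈ V k ∨ ∀ l, x ∉ V l := by
    intro x
    by_cases h : ∃ k, x ∈ V k
    · exact h.imp fun k hk => Or.inl hk
    · exact ⟨0, Or.inr (not_exists.1 h)⟩
  refine ⟨fun x => Nat.find (hex x), measurable_find hex fun k => ?_, ?_⟩
  · simp only [ofPred_or, ofPred_forall]
    refine (hV k).union ?_
    exact MeasurableSet.iInter fun l => (hV l).compl
  have hae : ∀ᵐ x ∂μ, ∀ i, ¬ ∃ n ≥ 1, T^[n] (T^[i] x) = T^[i] x := by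
    rw [ae_all_iff]
    intro i
    exact (hTi i).quasiMeasurePreserving.ae (p := fun x => ¬ ∃ n ≥ 1, T^[n] x = x)
      (by rw [ae_iff]; simpa only [not_not] using haper)
  filter_upwards [hae] with x hx i j hij hjN
  have hmem : ∀ i, ∃ k, T^[i] x ∈ V k := by
    intro i
    have hfin : IsClosed ((fun l => f (T^[l] (T^[i] x))) '' (Finset.Icc 1 N : Set ℕ)) :=
      ((Finset.finite_toSet _).image _).isClosed
    have hnot : f (T^[i] x) ∉ (fun l => f (T^[l] (T^[i] x))) '' (Finset.Icc 1 N : Set ℕ) := by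
      rintro ⟨l, hl, he⟩
      rw [Finset.mem_coe, Finset.mem_Icc] at hl
      exact hx i ⟨l, hl.1, hf.injective he⟩
    obtain ⟨v, hv, hxv, hsub⟩ := hb.exists_subset_of_mem_open (mem_compl hnot) hfin.isOpen_compl
    rw [hU] at hv
    obtain ⟨k, rfl⟩ := hv
    exact ⟨k, hxv, fun l hl hlk => hsub hlk ⟨l, hl, rfl⟩⟩
  have hspec : ∀ i, T^[i] x ∈ V (Nat.find (hex (T^[i] x))) := by
    intro i
    obtain ⟨k, hk⟩ := hmem i
    exact (Nat.find_spec (hex (T^[i] x))).resolve_right fun h => h k hk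
  intro he
  have h1 := (hspec i).2 (j - i) (Finset.mem_Icc.2 ⟨by omega, by omega⟩)
  rw [← Function.iterate_add_apply, Nat.sub_add_cancel hij.le] at h1
  have h2 := (hspec j).1
  rw [← he] at h2
  exact h1 h2

/-- An aperiodic system contains a set of measure at most `1 / (N + 1)` which is visited by all
orbits starting outside of a set of measure at most `δ`. -/
theorem exists_small_set_hit {Ω : Type*} [MeasurableSpace Ω] [StandardBorelSpace Ω]
    {μ : Measure Ω} [IsProbabilityMeasure μ] {T : Ω → Ω} (hT : MeasurePreserving T μ μ)
    (haper : μ {x | ∃ n ≥ 1, T^[n] x = x} = 0) (N : ℕ) {δ : ℝ} (hδ : 0 < δ) :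
    ∃ B : Set Ω, MeasurableSet B ∧ μ.real B ≤ 1 / (N + 1) ∧
      μ.real {x | ∀ t, T^[t] x ∉ B} ≤ δ := by
  have hTi : ∀ i, MeasurePreserving T^[i] μ μ := fun i => hT.iterate i
  obtain ⟨m, hm, hmae⟩ := exists_measurable_nat_coloring hT haper N
  have hmi : ∀ i, Measurable fun x => m (T^[i] x) := fun i => hm.comp (hTi i).measurable
  let B : Set Ω := {x | ∀ j, j ≤ 2 * N → j ≠ N → m (T^[N] x) < m (T^[j] x)}
  have hB : MeasurableSet B := by
    simp only [B, ofPred_forall]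
    exact MeasurableSet.iInter fun j => MeasurableSet.iInter fun _ => MeasurableSet.iInter fun _ =>
      measurableSet_lt (hmi N) (hmi j)
  refine ⟨B, hB, ?_, ?_⟩
  · have hdisj : (↑(Finset.range (N + 1)) : Set ℕ).PairwiseDisjoint
        (fun i => T^[i] ⁻¹' B) := by
      have key : ∀ i j, i < j → j < N + 1 → ∀ x, T^[i] x ∈ B → T^[j] x ∉ B := by
        intro i j hij hj x h1 h2
        have h1' := h1 (N + (j - i)) (by omega) (by omega)
        have h2' := h2 (N - (j - i)) (by omega) (by omega)
        simp only [← Function.iterate_add_apply] at h1' h2'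
        rw [show N + (j - i) + i = N + j by omega] at h1'
        rw [show N - (j - i) + j = N + i by omega] at h2'
        exact lt_asymm h1' h2'
      intro i hi j hj hne
      rw [Finset.coe_range, mem_Iio] at hi hj
      rw [Function.onFun, Set.disjoint_left]
      rcases lt_or_gt_of_ne hne with h | h
      · exact fun x hx => key i j h hj x hx
      · exact fun x hx hx' => key j i h hi x hx' hx
    have hsum := measureReal_biUnion_finset (μ := μ) hdisj fun i _ => (hTi i).measurable hB
    simp only [(hTi _).measureReal_preimage hB.nullMeasurableSet, Finset.sum_const,
      Finset.card_range, nsmul_eq_mul] at hsum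
    have hle : μ.real (⋃ i ∈ Finset.range (N + 1), T^[i] ⁻¹' B) ≤ 1 := measureReal_le_one
    rw [hsum] at hle
    push_cast at hle
    rw [le_div_iff₀ (by positivity)]
    linarith
  · have hlim : Tendsto (fun K : ℕ => μ.real {x | K < m x}) atTop (𝓝 0) := by
      have h := tendsto_measure_iInter_atTop (μ := μ) (s := fun K : ℕ => {x | K < m x})
        (fun K => (measurableSet_lt measurable_const hm).nullMeasurableSet)
        (fun K L hKL x (hx : L < m x) => lt_of_le_of_lt hKL hx) ⟨0, measure_ne_top _ _⟩
      have he : ⋂ K : ℕ, {x | K < m x} = ∅ := by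
        ext x
        simp only [mem_iInter, mem_ofPred_eq, mem_empty_iff_false, iff_false, not_forall, not_lt]
        exact ⟨m x, le_rfl⟩
      rw [he, measure_empty] at h
      exact (ENNReal.tendsto_toReal ENNReal.zero_ne_top).comp h
    obtain ⟨K, hK⟩ := (hlim.eventually_le_const hδ).exists
    have hpre := (hTi ((K + 1) * N)).measureReal_preimage
      (s := {x | K < m x}) (measurableSet_lt measurable_const hm).nullMeasurableSet
    rw [← hpre] at hK
    refine le_trans ?_ hK
    refine ENNReal.toReal_mono (measure_ne_top _ _) (measure_mono_ae ?_)
    filter_upwards [hmae] with x hx hxB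
    have key : ∀ k n, (k + 1) * N ≤ n → m (T^[n] x) ≤ k → False := by
      intro k
      induction k with
      | zero =>
        intro n hn hk
        have := hxB (n - N)
        simp only [B, mem_ofPred_eq, not_forall, not_lt] at this
        obtain ⟨j, hj, hjN, hle⟩ := this
        simp only [← Function.iterate_add_apply] at hle
        rw [show N + (n - N) = n by omega] at hle
        rcases lt_or_gt_of_ne hjN with h | h
        · have := hx (j + (n - N)) n (by omega) (by omega)
          omega
        · have := hx n (j + (n - N)) (by omega) (by omega)
          omega
      | succ k ih =>
        intro n hn hk
        have hn' : (k + 1 + 1) * N = (k + 1) * N + N := by ring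
        have := hxB (n - N)
        simp only [B, mem_ofPred_eq, not_forall, not_lt] at this
        obtain ⟨j, hj, hjN, hle⟩ := this
        simp only [← Function.iterate_add_apply] at hle
        rw [show N + (n - N) = n by omega] at hle
        refine ih (j + (n - N)) (by omega) ?_
        rcases lt_or_gt_of_ne hjN with h | h
        · have := hx (j + (n - N)) n (by omega) (by omega)
          omega
        · have := hx n (j + (n - N)) (by omega) (by omega)
          omega
    exact not_le.1 fun h => key K _ le_rfl h

/-- An aperiodic system admits a measurable `p`-valued clock which advances by one modulo `p`
outside of a set of small measure. -/
theorem exists_measurable_clock {Ω : Type*} [MeasurableSpace Ω] [StandardBorelSpace Ω]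
    {μ : Measure Ω} [IsProbabilityMeasure μ] {T : Ω → Ω} (hT : MeasurePreserving T μ μ)
    (haper : μ {x | ∃ n ≥ 1, T^[n] x = x} = 0) {p : ℕ} (hp : 0 < p) {δ : ℝ} (hδ : 0 < δ) :
    ∃ c : Ω → ℕ, Measurable c ∧ (∀ x, c x < p) ∧
      μ.real {x | c (T x) ≠ (c x + 1) % p} ≤ δ := by
  classical
  obtain ⟨N, hN⟩ := exists_nat_one_div_lt (half_pos hδ)
  obtain ⟨B, hB, hBN, hBδ⟩ := exists_small_set_hit hT haper N (half_pos hδ)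
  have hex : ∀ x, ∃ t, T^[t] x ∈ B ∨ ∀ s, T^[s] x ∉ B := by
    intro x
    by_cases h : ∃ t, T^[t] x ∈ B
    · exact h.imp fun k hk => Or.inl hk
    · exact ⟨0, Or.inr (not_exists.1 h)⟩
  have hmeas : Measurable fun x => Nat.find (hex x) := by
    refine measurable_find hex fun t => ?_
    simp only [ofPred_or, ofPred_forall]
    refine ((hT.iterate t).measurable hB).union ?_
    exact MeasurableSet.iInter fun s => ((hT.iterate s).measurable hB).compl
  refine ⟨fun x => p - 1 - Nat.find (hex x) % p,
    (measurable_of_countable fun n : ℕ => p - 1 - n % p).comp hmeas, fun x => by dsimp only; omega, ?_⟩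
  have hsub : {x | p - 1 - Nat.find (hex (T x)) % p ≠ (p - 1 - Nat.find (hex x) % p + 1) % p} ⊆
      B ∪ {x | ∀ t, T^[t] x ∉ B} := by
    intro x hx
    by_contra hcon
    simp only [mem_union, mem_ofPred_eq, not_or, not_forall, not_not] at hcon
    obtain ⟨hxB, t, ht⟩ := hcon
    apply hx
    have hfind : Nat.find (hex x) = Nat.find (hex (T x)) + 1 := by
      refine (Nat.find_eq_iff _).2 ⟨?_, ?_⟩
      · refine Or.inl ?_
        rw [Function.iterate_succ_apply]
        refine (Nat.find_spec (hex (T x))).resolve_right fun h => ?_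
        cases t with
        | zero => exact hxB ht
        | succ t => exact h t (by rwa [Function.iterate_succ_apply] at ht)
      · rintro n hn (h | h)
        · cases n with
          | zero => exact hxB h
          | succ n =>
            rw [Function.iterate_succ_apply] at h
            exact Nat.find_min (hex (T x)) (Nat.lt_of_succ_lt_succ hn) (Or.inl h)
        · exact h t ht
    rw [hfind]
    generalize Nat.find (hex (T x)) = n
    have h1 : n % p < p := Nat.mod_lt _ hp
    rw [Nat.add_mod n 1 p]
    rcases Nat.lt_or_ge 1 p with h | h
    · rw [Nat.mod_eq_of_lt h]
      rcases Nat.lt_or_ge (n % p + 1) p with h' | h'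
      · rw [Nat.mod_eq_of_lt h', Nat.mod_eq_of_lt (a := p - 1 - (n % p + 1) + 1) (by omega)]
        omega
      · have h2 : n % p = p - 1 := by omega
        rw [h2, Nat.sub_add_cancel hp, Nat.mod_self, Nat.sub_zero, Nat.sub_add_cancel hp,
          Nat.mod_self, Nat.sub_self]
    · obtain rfl : p = 1 := by omega
      simp [Nat.mod_one]
  calc _ ≤ μ.real (B ∪ {x | ∀ t, T^[t] x ∉ B}) := measureReal_mono hsub
    _ ≤ μ.real B + μ.real {x | ∀ t, T^[t] x ∉ B} := measureReal_union_le _ _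
    _ ≤ δ := by linarith

/-- A random variable close to one whose distribution function is close to that of `ν` has a law
close to `ν` in the Lévy metric. -/
theorem levyDist_map_le_of_approx {Ω : Type*} [MeasurableSpace Ω] {μ : Measure Ω}
    [IsProbabilityMeasure μ] {ν : Measure ℝ} [IsProbabilityMeasure ν] {X Y : Ω → ℝ}
    (hX : Measurable X) {s : Set Ω} {κ η ε : ℝ} (hs : μ.real s ≤ κ)
    (hXY : ∀ x ∉ s, |X x - Y x| ≤ κ)
    (hY_le : ∀ t, μ.real {x | Y x ≤ t} ≤ ν.real (Iic (t + η)) + η)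
    (hY_ge : ∀ t, ν.real (Iic (t - η)) - η ≤ μ.real {x | Y x ≤ t})
    (hε : 0 < ε) (hκη : κ + η ≤ ε) :
    levyDist (μ.map X) ν ≤ ε := by
  have : IsProbabilityMeasure (μ.map X) := Measure.isProbabilityMeasure_map hX.aemeasurable
  refine csInf_le ⟨0, fun r hr => hr.1.le⟩ ⟨hε, fun t => ?_⟩
  rw [ProbabilityTheory.cdf_eq_real, ProbabilityTheory.cdf_eq_real, ProbabilityTheory.cdf_eq_real,
    map_measureReal_apply hX measurableSet_Iic]
  constructor
  · have hsub : {x | Y x ≤ t - κ} ⊆ X ⁻¹' Iic t ∪ s := by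
      intro x hx
      by_cases hxs : x ∈ s
      · exact Or.inr hxs
      · have := abs_le.1 (hXY x hxs)
        have hx' : Y x ≤ t - κ := hx
        exact Or.inl (show X x ≤ t by linarith)
    have h1 := (measureReal_mono (μ := μ) hsub).trans (measureReal_union_le _ _)
    have h2 := hY_ge (t - κ)
    have h3 : ν.real (Iic (t - ε)) ≤ ν.real (Iic (t - κ - η)) :=
      measureReal_mono (Iic_subset_Iic.2 (by linarith))
    linarith
  · have hsub : X ⁻¹' Iic t ⊆ {x | Y x ≤ t + κ} ∪ s := by
      intro x hx
      by_cases hxs : x ∈ s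
      · exact Or.inr hxs
      · have := abs_le.1 (hXY x hxs)
        have hx' : X x ≤ t := hx
        exact Or.inl (show Y x ≤ t + κ by linarith)
    have h1 := (measureReal_mono (μ := μ) hsub).trans (measureReal_union_le _ _)
    have h2 := hY_le (t + κ)
    have h3 : ν.real (Iic (t + κ + η)) ≤ ν.real (Iic (t + ε)) :=
      measureReal_mono (Iic_subset_Iic.2 (by linarith))
    linarith

/-- Sums over a product range, split into consecutive blocks. -/
theorem sum_range_mul_eq_sum_blocks (f : ℕ → ℝ) (k M : ℕ) :
    ∑ s ∈ Finset.range (k * M), f s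
      = ∑ j ∈ Finset.range k, ∑ r ∈ Finset.range M, f (j * M + r) := by
  induction k with
  | zero => simp
  | succ k ih => rw [Nat.succ_mul, Finset.sum_range_add, ih, Finset.sum_range_succ]

/-- A full cycle of residues has the same sum wherever it starts. -/
theorem sum_range_add_mod (f : ℕ → ℝ) (p s : ℕ) :
    ∑ i ∈ Finset.range p, f ((s + i) % p) = ∑ i ∈ Finset.range p, f i := by
  induction s with
  | zero =>
    refine Finset.sum_congr rfl fun i hi => ?_
    rw [Nat.zero_add, Nat.mod_eq_of_lt (Finset.mem_range.1 hi)]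
  | succ s ih =>
    rw [← ih]
    have h1 := Finset.sum_range_succ (fun i => f ((s + i) % p)) p
    have h2 := Finset.sum_range_succ' (fun i => f ((s + i) % p)) p
    rw [Nat.add_mod_right] at h1
    rw [Nat.add_zero] at h2
    have h3 : ∀ i, s + 1 + i = s + (i + 1) := fun i => by ring
    simp only [h3]
    exact add_right_cancel (h2.symm.trans h1)

/-- Partial sums of a periodic sequence with values in `[0, 1]` differ from the partial sums of
its mean by at most the period. -/
theorem abs_sum_mod_sub_le {f : ℕ → ℝ} (hf0 : ∀ i, 0 ≤ f i) (hf1 : ∀ i, f i ≤ 1) {p : ℕ}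
    (hp : 0 < p) (n s : ℕ) :
    |∑ i ∈ Finset.range n, f ((s + i) % p) - n * ((∑ i ∈ Finset.range p, f i) / p)| ≤ p := by
  have hp' : (0 : ℝ) < p := Nat.cast_pos.2 hp
  set q := (∑ i ∈ Finset.range p, f i) / p with hq
  have hq0 : 0 ≤ q := div_nonneg (Finset.sum_nonneg fun i _ => hf0 i) hp'.le
  have hq1 : q ≤ 1 := by
    rw [hq, div_le_one hp']
    simpa using Finset.sum_le_sum (s := Finset.range p) fun i _ => hf1 i
  induction n using Nat.strong_induction_on generalizing s with
  | _ n ih =>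
    rcases lt_or_ge n p with h | h
    · have h0 : 0 ≤ ∑ i ∈ Finset.range n, f ((s + i) % p) := Finset.sum_nonneg fun i _ => hf0 _
      have h1 : ∑ i ∈ Finset.range n, f ((s + i) % p) ≤ n := by
        simpa using Finset.sum_le_sum (s := Finset.range n) fun i _ => hf1 ((s + i) % p)
      have hn : (n : ℝ) ≤ p := by exact_mod_cast h.le
      have hn0 : (0 : ℝ) ≤ n := n.cast_nonneg
      rw [abs_le]
      constructor <;> nlinarith
    · obtain ⟨m, rfl⟩ := Nat.exists_eq_add_of_le h
      have h1 := ih m (by omega) (s + p)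
      rw [Finset.sum_range_add, sum_range_add_mod]
      have h2 : ∑ i ∈ Finset.range p, f i = p * q := by rw [hq]; field_simp
      simp only [← Nat.add_assoc]
      rw [h2]
      push_cast
      convert h1 using 2
      ring

/-- A set of integers whose density on the `j`-th block of length `M` is `d j`. -/
theorem exists_set_block_density {d : ℕ → ℝ} (hd0 : ∀ j, 0 ≤ d j) (hd1 : ∀ j, d j ≤ 1) {M : ℕ}
    (hM : 0 < M) :
    ∃ W : Set ℕ,
      (∀ s n, s % M + n ≤ M →
        |∑ i ∈ Finset.range n, W.indicator (fun _ => (1 : ℝ)) (s + i) - n * d (s / M)| ≤ 1) ∧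
      ∀ k, |∑ i ∈ Finset.range (k * M), W.indicator (fun _ => (1 : ℝ)) i
        - M * ∑ j ∈ Finset.range k, d j| ≤ 1 := by
  let D : ℕ → ℝ := fun s => ∑ i ∈ Finset.range s, d (i / M)
  let W : Set ℕ := {s | ⌊D (s + 1)⌋ ≠ ⌊D s⌋}
  have hDs : ∀ s, D (s + 1) = D s + d (s / M) := fun s => Finset.sum_range_succ _ _
  have hW : ∀ s, W.indicator (fun _ => (1 : ℝ)) s = ⌊D (s + 1)⌋ - ⌊D s⌋ := by
    intro s
    have h1 : ⌊D s⌋ ≤ ⌊D (s + 1)⌋ := Int.floor_mono (by rw [hDs]; linarith [hd0 (s / M)])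
    have h2 : ⌊D (s + 1)⌋ ≤ ⌊D s⌋ + 1 := by
      rw [← Int.floor_add_one]
      exact Int.floor_mono (by rw [hDs]; linarith [hd1 (s / M)])
    by_cases h : ⌊D (s + 1)⌋ = ⌊D s⌋
    · rw [indicator_of_notMem (by simpa [W] using h), h, sub_self]
    · rw [indicator_of_mem (show s ∈ W from h), show ⌊D (s + 1)⌋ = ⌊D s⌋ + 1 by omega]
      push_cast
      ring
  have hsum : ∀ s n, |∑ i ∈ Finset.range n, W.indicator (fun _ => (1 : ℝ)) (s + i)
      - (D (s + n) - D s)| ≤ 1 := by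
    intro s n
    have h := Finset.sum_range_sub (fun i => (⌊D (s + i)⌋ : ℝ)) n
    simp only [hW, Nat.add_assoc]
    rw [h, Nat.add_zero, abs_le]
    have h1 := Int.floor_le (D (s + n))
    have h2 := Int.lt_floor_add_one (D (s + n))
    have h3 := Int.floor_le (D s)
    have h4 := Int.lt_floor_add_one (D s)
    constructor <;> linarith
  refine ⟨W, fun s n hsn => ?_, fun k => ?_⟩
  · have h1 : D (s + n) - D s = n * d (s / M) := by
      simp only [D]
      rw [Finset.sum_range_add, add_sub_cancel_left, Finset.sum_congr rfl
        (g := fun _ => d (s / M)), Finset.sum_const, Finset.card_range, nsmul_eq_mul]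
      intro i hi
      have hi' := Finset.mem_range.1 hi
      congr 1
      rw [Nat.div_eq_iff hM]
      have := Nat.div_add_mod s M
      rw [Nat.mul_comm] at this
      have : (s / M + 1) * M = s / M * M + M := by ring
      omega
    rw [← h1]
    exact hsum s n
  · have h1 : D (0 + k * M) - D 0 = M * ∑ j ∈ Finset.range k, d j := by
      simp only [D, Nat.zero_add]
      rw [sum_range_mul_eq_sum_blocks, Finset.range_zero, Finset.sum_empty, sub_zero,
        Finset.mul_sum]
      refine Finset.sum_congr rfl fun j _ => ?_
      rw [Finset.sum_congr rfl (g := fun _ => d j), Finset.sum_const, Finset.card_range,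
        nsmul_eq_mul]
      intro r hr
      congr 1
      rw [Nat.mul_comm, Nat.mul_add_div hM, Nat.div_eq_of_lt (Finset.mem_range.1 hr), Nat.add_zero]
    rw [← h1]
    simpa only [Nat.zero_add] using hsum 0 (k * M)

/-- The set of points whose clock advances correctly during `n` steps. -/
def clockGoodSet {Ω : Type*} (T : Ω → Ω) (c : Ω → ℕ) (p n : ℕ) : Set Ω :=
  {x | ∀ i < n, c (T (T^[i] x)) = (c (T^[i] x) + 1) % p}

theorem clock_iterate_of_mem_goodSet {Ω : Type*} {T : Ω → Ω} {c : Ω → ℕ} {p n : ℕ}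
    (hcp : ∀ x, c x < p) {x : Ω} (hx : x ∈ clockGoodSet T c p n) :
    ∀ i ≤ n, c (T^[i] x) = (c x + i) % p := by
  intro i
  induction i with
  | zero => exact fun _ => (Nat.mod_eq_of_lt (hcp x)).symm
  | succ i ih =>
    intro hi
    rw [Function.iterate_succ_apply', hx i hi, ih (by omega), Nat.mod_add_mod, Nat.add_assoc]

theorem measurableSet_clockGoodSet {Ω : Type*} [MeasurableSpace Ω] {T : Ω → Ω}
    (hT : Measurable T) {c : Ω → ℕ} (hc : Measurable c) (p n : ℕ) :
    MeasurableSet (clockGoodSet T c p n) := by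
  simp only [clockGoodSet, ofPred_forall]
  exact MeasurableSet.iInter fun i => MeasurableSet.iInter fun _ =>
    measurableSet_eq_fun (hc.comp (hT.comp (hT.iterate i)))
      ((measurable_of_countable fun m : ℕ => (m + 1) % p).comp (hc.comp (hT.iterate i)))

theorem measureReal_compl_clockGoodSet_le {Ω : Type*} [MeasurableSpace Ω] {μ : Measure Ω}
    [IsProbabilityMeasure μ] {T : Ω → Ω} (hT : MeasurePreserving T μ μ) {c : Ω → ℕ}
    (hc : Measurable c) {p : ℕ} {δ : ℝ}
    (hδ : μ.real {x | c (T x) ≠ (c x + 1) % p} ≤ δ) (n : ℕ) :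
    μ.real (clockGoodSet T c p n)ᶜ ≤ n * δ := by
  have hmeas : MeasurableSet {x | c (T x) ≠ (c x + 1) % p} :=
    (measurableSet_eq_fun (hc.comp hT.measurable)
      ((measurable_of_countable fun m : ℕ => (m + 1) % p).comp hc)).compl
  have hsub : (clockGoodSet T c p n)ᶜ ⊆
      ⋃ i ∈ Finset.range n, T^[i] ⁻¹' {x | c (T x) ≠ (c x + 1) % p} := by
    intro x hx
    simp only [clockGoodSet, mem_compl_iff, mem_ofPred_eq, not_forall] at hx
    obtain ⟨i, hi, h⟩ := hx
    exact mem_biUnion (Finset.mem_coe.2 (Finset.mem_range.2 hi)) h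
  calc _ ≤ _ := measureReal_mono hsub (measure_ne_top _ _)
    _ ≤ ∑ i ∈ Finset.range n, μ.real (T^[i] ⁻¹' {x | c (T x) ≠ (c x + 1) % p}) :=
      measureReal_biUnion_finset_le _ _
    _ ≤ ∑ i ∈ Finset.range n, δ := Finset.sum_le_sum fun i _ => by
      rwa [(hT.iterate i).measureReal_preimage hmeas.nullMeasurableSet]
    _ = n * δ := by simp

/-- The clock is nearly uniformly distributed. -/
theorem abs_measureReal_clock_sub_le {Ω : Type*} [MeasurableSpace Ω] {μ : Measure Ω}
    [IsProbabilityMeasure μ] {T : Ω → Ω} (hT : MeasurePreserving T μ μ) {c : Ω → ℕ}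
    (hc : Measurable c) {p n : ℕ} (hp : 0 < p) (hcp : ∀ x, c x < p) (hpn : p ≤ n) (J : Set ℕ) :
    |μ.real (c ⁻¹' J) - (∑ i ∈ Finset.range p, J.indicator (fun _ => (1 : ℝ)) i) / p|
      ≤ μ.real (clockGoodSet T c p n)ᶜ := by
  have hp' : (0 : ℝ) < p := Nat.cast_pos.2 hp
  have hJ : MeasurableSet (c ⁻¹' J) := hc J.to_countable.measurableSet
  have hE := measurableSet_clockGoodSet hT.measurable hc p n
  set E := clockGoodSet T c p n with hEdef
  set q := ∑ i ∈ Finset.range p, J.indicator (fun _ => (1 : ℝ)) i with hq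
  have hJ0 : ∀ i, 0 ≤ J.indicator (fun _ => (1 : ℝ)) i := fun i =>
    indicator_nonneg (fun _ _ => zero_le_one) i
  have hJ1 : ∀ i, J.indicator (fun _ => (1 : ℝ)) i ≤ 1 := fun i =>
    indicator_le_self' (f := fun _ : ℕ => (1 : ℝ)) (fun _ _ => zero_le_one) i
  have hsum0 : ∀ g : ℕ → ℕ, 0 ≤ ∑ i ∈ Finset.range p, J.indicator (fun _ => (1 : ℝ)) (g i) :=
    fun g => Finset.sum_nonneg fun i _ => hJ0 _
  have hsum1 : ∀ g : ℕ → ℕ, ∑ i ∈ Finset.range p, J.indicator (fun _ => (1 : ℝ)) (g i) ≤ p :=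
    fun g => by simpa using Finset.sum_le_sum (s := Finset.range p) fun i _ => hJ1 (g i)
  let h : Ω → ℝ := fun x => ∑ i ∈ Finset.range p, J.indicator (fun _ => (1 : ℝ)) (c (T^[i] x))
  have hJint : ∀ i, Integrable (fun x => J.indicator (fun _ => (1 : ℝ)) (c (T^[i] x))) μ := by
    intro i
    have : (fun x => J.indicator (fun _ => (1 : ℝ)) (c (T^[i] x)))
        = (T^[i] ⁻¹' (c ⁻¹' J)).indicator fun _ => 1 := by
      ext x
      rfl
    rw [this]
    exact (integrable_const _).indicator ((hT.iterate i).measurable hJ)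
  have hh : ∫ x, h x ∂μ = p * μ.real (c ⁻¹' J) := by
    simp only [h]
    rw [integral_finsetSum _ fun i _ => hJint i]
    have : ∀ i, ∫ x, J.indicator (fun _ => (1 : ℝ)) (c (T^[i] x)) ∂μ = μ.real (c ⁻¹' J) := by
      intro i
      rw [← (hT.iterate i).measureReal_preimage hJ.nullMeasurableSet,
        ← integral_indicator_one ((hT.iterate i).measurable hJ)]
      rfl
    simp [this]
  have hh_int : Integrable h μ := integrable_finsetSum _ fun i _ => hJint i
  have hpt : ∀ x, |h x - q| ≤ Eᶜ.indicator (fun _ => (p : ℝ)) x := by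
    intro x
    by_cases hx : x ∈ E
    · rw [indicator_of_notMem (notMem_compl_iff.2 hx)]
      have : h x = q := by
        simp only [h, hq]
        refine Eq.trans ?_ (sum_range_add_mod _ p (c x))
        refine Finset.sum_congr rfl fun i hi => ?_
        rw [clock_iterate_of_mem_goodSet hcp hx i ((Finset.mem_range.1 hi).le.trans hpn)]
      rw [this, sub_self, abs_zero]
    · rw [indicator_of_mem (mem_compl hx), abs_le]
      have h1 := hsum0 fun i => c (T^[i] x)
      have h2 := hsum1 fun i => c (T^[i] x)
      have h3 := hsum0 id
      have h4 := hsum1 id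
      simp only [id] at h3 h4
      constructor <;> simp only [h, hq] <;> linarith
  have hmain : |∫ x, (h x - q) ∂μ| ≤ μ.real Eᶜ * p := by
    refine (abs_integral_le_integral_abs).trans ?_
    calc _ ≤ ∫ x, Eᶜ.indicator (fun _ => (p : ℝ)) x ∂μ :=
          integral_mono (hh_int.sub (integrable_const _)).abs
            ((integrable_const _).indicator hE.compl) hpt
      _ = _ := by rw [integral_indicator_const _ hE.compl, smul_eq_mul]
  rw [integral_sub hh_int (integrable_const _), hh, integral_const, probReal_univ, one_smul] at hmain
  have : μ.real (c ⁻¹' J) - q / p = (p * μ.real (c ⁻¹' J) - q) / p := by field_simp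
  rw [this, abs_div, abs_of_pos hp', div_le_iff₀ hp']
  exact hmain

/-- An integrable probability measure on `ℝ` with zero mean is close to the empirical measure of
a finite sequence whose mean is close to zero. -/
theorem exists_empirical_approx (ν : Measure ℝ) [IsProbabilityMeasure ν]
    (hν_int : Integrable (fun x : ℝ => x) ν) (hν_mean : ∫ x, x ∂ν = 0) {η : ℝ} (hη : 0 < η) :
    ∃ (k : ℕ) (y : ℕ → ℝ), 0 < k ∧ (∃ R, ∀ i, |y i| ≤ R) ∧
      |(∑ i ∈ Finset.range k, y i) / k| ≤ η ∧
      ∀ t, (∑ i ∈ Finset.range k, (Iic t).indicator (fun _ => (1 : ℝ)) (y i)) / k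
          ≤ ν.real (Iic (t + η)) + η ∧
        ν.real (Iic (t - η)) - η
          ≤ (∑ i ∈ Finset.range k, (Iic t).indicator (fun _ => (1 : ℝ)) (y i)) / k := by
  obtain ⟨L, hL⟩ : ∃ L, ν.real (Iic L) ≤ η / 2 := by
    obtain ⟨L, hL⟩ :=
      ((ProbabilityTheory.tendsto_cdf_atBot ν).eventually_le_const (half_pos hη)).exists
    exact ⟨L, by rwa [← ProbabilityTheory.cdf_eq_real]⟩
  obtain ⟨R, hR⟩ : ∃ R, 1 - η / 2 ≤ ν.real (Iic R) := by
    obtain ⟨R, hR⟩ := ((ProbabilityTheory.tendsto_cdf_atTop ν).eventually_const_le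
      (show 1 - η / 2 < 1 by linarith)).exists
    exact ⟨R, by rwa [← ProbabilityTheory.cdf_eq_real]⟩
  obtain ⟨n, hn⟩ := exists_nat_ge ((R - L) / η)
  rw [div_le_iff₀ hη] at hn
  obtain ⟨Ω, _, P, X, hXm, hXl, hXi, _⟩ := ProbabilityTheory.exists_iid ℕ ν
  have hident : ∀ i, ProbabilityTheory.IdentDistrib (X i) (X 0) P P := fun i =>
    (hXl i).identDistrib (hXl 0)
  have hpair : Pairwise (Function.onFun (fun f g => ProbabilityTheory.IndepFun f g P) X) :=
    fun i j hij => hXi.indepFun hij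
  have hmean : ∀ᵐ ω ∂P, Tendsto (fun n : ℕ => (∑ i ∈ Finset.range n, X i ω) / n) atTop
      (𝓝 0) := by
    have h := ProbabilityTheory.strong_law_ae_real X
      (by
        have h := hν_int
        rw [← (hXl 0).map_eq] at h
        exact h.comp_measurable (hXm 0)) hpair hident
    rwa [(hXl 0).integral_eq, hν_mean] at h
  have hcdf : ∀ t, ∀ᵐ ω ∂P, Tendsto (fun n : ℕ =>
      (∑ i ∈ Finset.range n, (Iic t).indicator (fun _ => (1 : ℝ)) (X i ω)) / n) atTop
      (𝓝 (ν.real (Iic t))) := by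
    intro t
    have hm : Measurable ((Iic t).indicator fun _ => (1 : ℝ)) :=
      measurable_const.indicator measurableSet_Iic
    have h := ProbabilityTheory.strong_law_ae_real
      (fun i ω => (Iic t).indicator (fun _ => (1 : ℝ)) (X i ω))
      (Integrable.of_bound (hm.comp (hXm 0)).aestronglyMeasurable 1 (ae_of_all _ fun ω => by
        refine (norm_indicator_le_norm_self (fun _ : ℝ => (1 : ℝ)) _).trans ?_
        simp))
      (fun i j hij => (hpair hij).comp hm hm) (fun i => (hident i).comp hm)
    have he : ∫ ω, (Iic t).indicator (fun _ => (1 : ℝ)) (X 0 ω) ∂P = ν.real (Iic t) := by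
      rw [← integral_indicator_one measurableSet_Iic,
        ← (hXl 0).integral_comp (f := (Iic t).indicator 1) hm.aestronglyMeasurable]
      rfl
    rwa [he] at h
  have hall : ∀ᵐ ω ∂P, ∀ j : ℕ, Tendsto (fun n : ℕ =>
      (∑ i ∈ Finset.range n, (Iic (L + j * η)).indicator (fun _ => (1 : ℝ)) (X i ω)) / n) atTop
      (𝓝 (ν.real (Iic (L + j * η)))) := ae_all_iff.2 fun j => hcdf _
  obtain ⟨ω, hω1, hω2⟩ := (hmean.and hall).exists
  have hev1 := (tendsto_order.1 hω1.abs).2 η (by simpa using hη)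
  have hev2 : ∀ᶠ k : ℕ in atTop, ∀ j ∈ Finset.range (n + 1),
      |(∑ i ∈ Finset.range k, (Iic (L + j * η)).indicator (fun _ => (1 : ℝ)) (X i ω)) / k
        - ν.real (Iic (L + j * η))| < η / 2 :=
    (Filter.eventually_all_finset _).2 fun j _ => by
      simpa only [Real.dist_eq] using Metric.tendsto_nhds.1 (hω2 j) (η / 2) (half_pos hη)
  obtain ⟨k, ⟨hk1, hk2⟩, hk0⟩ := ((hev1.and hev2).and (eventually_gt_atTop 0)).exists
  have hk0' : (0 : ℝ) < k := Nat.cast_pos.2 hk0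
  let y : ℕ → ℝ := fun i => if i < k then X i ω else 0
  have hy : ∀ i ∈ Finset.range k, y i = X i ω := fun i hi => if_pos (Finset.mem_range.1 hi)
  refine ⟨k, y, hk0, ⟨∑ i ∈ Finset.range k, |X i ω|, fun i => ?_⟩, ?_, ?_⟩
  · by_cases hi : i < k
    · rw [hy i (Finset.mem_range.2 hi)]
      exact Finset.single_le_sum (f := fun i => |X i ω|) (fun _ _ => abs_nonneg _)
        (Finset.mem_range.2 hi)
    · simp only [y, if_neg hi, abs_zero]
      exact Finset.sum_nonneg fun _ _ => abs_nonneg _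
  · rw [Finset.sum_congr rfl hy]
    exact hk1.le
  · let G : ℝ → ℝ := fun t =>
      (∑ i ∈ Finset.range k, (Iic t).indicator (fun _ => (1 : ℝ)) (X i ω)) / k
    have hG : ∀ t, (∑ i ∈ Finset.range k, (Iic t).indicator (fun _ => (1 : ℝ)) (y i)) / k
        = G t := by
      intro t
      rw [Finset.sum_congr rfl fun i hi => by rw [hy i hi]]
    have hGmono : Monotone G := fun s t hst => by
      refine div_le_div_of_nonneg_right (Finset.sum_le_sum fun i _ => ?_) hk0'.le
      exact indicator_le_indicator_of_subset (Iic_subset_Iic.2 hst) (fun _ => zero_le_one) _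
    have hG0 : ∀ t, 0 ≤ G t := fun t => div_nonneg (Finset.sum_nonneg fun i _ =>
      indicator_nonneg (fun _ _ => zero_le_one) _) hk0'.le
    have hG1 : ∀ t, G t ≤ 1 := by
      intro t
      refine (div_le_one hk0').2 ?_
      have := Finset.sum_le_sum (s := Finset.range k) fun i _ =>
        indicator_le_self' (s := Iic t) (f := fun _ : ℝ => (1 : ℝ)) (fun _ _ => zero_le_one)
          (X i ω)
      simpa using this
    have hFmono : ∀ s t : ℝ, s ≤ t → ν.real (Iic s) ≤ ν.real (Iic t) := fun s t hst =>
      measureReal_mono (Iic_subset_Iic.2 hst)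
    have hF0 : ∀ t, 0 ≤ ν.real (Iic t) := fun t => measureReal_nonneg
    have hGF : ∀ j ≤ n, |G (L + j * η) - ν.real (Iic (L + j * η))| < η / 2 := fun j hj =>
      hk2 j (Finset.mem_range.2 (by omega))
    intro t
    rw [hG]
    rcases lt_or_ge t L with ht | ht
    · have h0 := abs_lt.1 (hGF 0 (Nat.zero_le _))
      simp only [Nat.cast_zero, zero_mul, add_zero] at h0
      have h1 := hGmono ht.le
      have h2 := hF0 (t + η)
      have h3 := hFmono (t - η) L (by linarith)
      have h4 := hG0 t
      constructor <;> linarith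
    · have hq : 0 ≤ (t - L) / η := div_nonneg (by linarith) hη.le
      have hj1 := Nat.floor_le hq
      have hj2 := Nat.lt_floor_add_one ((t - L) / η)
      generalize ⌊(t - L) / η⌋₊ = j at hj1 hj2
      rw [le_div_iff₀ hη] at hj1
      rw [div_lt_iff₀ hη] at hj2
      rcases lt_or_ge j n with hj | hj
      · have h0 := abs_lt.1 (hGF j hj.le)
        have h1 := abs_lt.1 (hGF (j + 1) hj)
        push_cast at h1
        have h2 := @hGmono (L + j * η) t (by linarith)
        have h3 := @hGmono t (L + (j + 1) * η) (by linarith)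
        have h4 := hFmono (L + (j + 1) * η) (t + η) (by linarith)
        have h5 := hFmono (t - η) (L + j * η) (by linarith)
        constructor <;> linarith
      · have hj' : (n : ℝ) * η ≤ j * η := by
          have : (n : ℝ) ≤ j := by exact_mod_cast hj
          exact mul_le_mul_of_nonneg_right this hη.le
        have h0 := abs_lt.1 (hGF n le_rfl)
        have h1 := hFmono R (L + n * η) (by linarith)
        have h2 := hFmono R (t + η) (by linarith)
        have h3 := @hGmono (L + n * η) t (by linarith)
        have h4 := hG1 t
        have h5 : ν.real (Iic (t - η)) ≤ 1 := measureReal_le_one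
        constructor <;> linarith

/-- At most `n` positions in each block of length `M` are at distance less than `n` from its
end. -/
theorem sum_indicator_near_block_end_le (n k M : ℕ) :
    ∑ i ∈ Finset.range (k * M), {s | M < s % M + n}.indicator (fun _ => (1 : ℝ)) i ≤ k * n := by
  have h : ∀ j, ∑ r ∈ Finset.range M,
      {s | M < s % M + n}.indicator (fun _ => (1 : ℝ)) (j * M + r) ≤ n := by
    intro j
    have h1 : ∀ r ∈ Finset.range M, {s | M < s % M + n}.indicator (fun _ => (1 : ℝ)) (j * M + r)
        = if M < r + n then 1 else 0 := by
      intro r hr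
      have h2 : j * M + r ∈ {s | M < s % M + n} ↔ M < r + n := by
        rw [mem_ofPred_eq, Nat.mul_comm, Nat.mul_add_mod,
          Nat.mod_eq_of_lt (Finset.mem_range.1 hr)]
      split_ifs with h3
      · exact indicator_of_mem (h2.2 h3) _
      · exact indicator_of_notMem (fun h4 => h3 (h2.1 h4)) _
    rw [Finset.sum_congr rfl h1, Finset.sum_boole]
    have h2 : (Finset.range M).filter (fun r => M < r + n) ⊆ Finset.Ico (M - n) M := by
      intro r hr
      simp only [Finset.mem_filter, Finset.mem_range, Finset.mem_Ico] at hr ⊢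
      omega
    have h3 := Finset.card_le_card h2
    rw [Nat.card_Ico] at h3
    exact_mod_cast (h3.trans (by omega : M - (M - n) ≤ n))
  rw [sum_range_mul_eq_sum_blocks]
  simpa using Finset.sum_le_sum (s := Finset.range k) fun j _ => h j

/-- The number of positions whose block index lies in a given set. -/
theorem sum_indicator_preimage_div {M : ℕ} (hM : 0 < M) (k : ℕ) (J : Set ℕ) :
    ∑ i ∈ Finset.range (k * M), ((· / M) ⁻¹' J).indicator (fun _ => (1 : ℝ)) i
      = M * ∑ j ∈ Finset.range k, J.indicator (fun _ => (1 : ℝ)) j := by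
  rw [sum_range_mul_eq_sum_blocks, Finset.mul_sum]
  refine Finset.sum_congr rfl fun j _ => ?_
  rw [Finset.sum_congr rfl (g := fun _ => J.indicator (fun _ => (1 : ℝ)) j), Finset.sum_const,
    Finset.card_range, nsmul_eq_mul]
  intro r hr
  have h : (j * M + r) / M = j := by
    rw [Nat.mul_comm, Nat.mul_add_div hM, Nat.div_eq_of_lt (Finset.mem_range.1 hr), Nat.add_zero]
  have h' : j * M + r ∈ (· / M) ⁻¹' J ↔ j ∈ J := by rw [mem_preimage, h]
  by_cases hj : j ∈ J
  · rw [indicator_of_mem hj, indicator_of_mem (h'.2 hj)]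
  · rw [indicator_of_notMem hj, indicator_of_notMem (mt h'.1 hj)]

set_option maxHeartbeats 1000000 in
/-- in an aperiodic system, given a zero-mean probability measure `ν` and
`ε, ε' > 0`, there are a set `A` with `μ A ≤ ε` and times `n₁ < n₂` such that the law of
the normalized partial sum at time `n₁` is `ε`-close to `ν` and at time `n₂` is
`ε'`-close to `δ₀`, in the Lévy metric. -/
theorem exists_set_two_times
    {Ω : Type*} [MeasurableSpace Ω] [StandardBorelSpace Ω]
    (μ : Measure Ω) [IsProbabilityMeasure μ]
    (T : Ω → Ω) (hT : MeasurePreserving T μ μ) (hTbij : Function.Bijective T)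
    (haper : μ {x | ∃ n ≥ 1, T^[n] x = x} = 0)
    (a : ℕ → ℝ) (ha_pos : ∀ n, 0 < a n) (ha_mono : Monotone a)
    (ha_top : Tendsto a atTop atTop)
    (ha_small : Tendsto (fun n => a n / n) atTop (𝓝 0))
    (ν : Measure ℝ) [IsProbabilityMeasure ν]
    (hν_int : Integrable (fun x : ℝ => x) ν) (hν_mean : ∫ x, x ∂ν = 0)
    (ε ε' : ℝ) (hε : 0 < ε) (hε' : 0 < ε') :
    ∃ A : Set Ω, ∃ n₁ n₂ : ℕ, MeasurableSet A ∧ 1 ≤ n₁ ∧ n₁ < n₂ ∧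
      μ A ≤ ENNReal.ofReal ε ∧
      levyDist
        (μ.map (fun x => (a n₁)⁻¹ *
          ∑ i ∈ Finset.range n₁,
            (A.indicator (fun _ => (1 : ℝ)) (T^[i] x) - (μ A).toReal)))
        ν ≤ ε ∧
      levyDist
        (μ.map (fun x => (a n₂)⁻¹ *
          ∑ i ∈ Finset.range n₂,
            (A.indicator (fun _ => (1 : ℝ)) (T^[i] x) - (μ A).toReal)))
        (Measure.dirac 0) ≤ ε' := by
  classical
  set γ : ℝ := min ε 1 with hγ
  have hγ0 : 0 < γ := lt_min hε one_pos
  have hγε : γ ≤ ε := min_le_left _ _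
  have hγ1 : γ ≤ 1 := min_le_right _ _
  obtain ⟨k, y, hk, ⟨R, hR⟩, hmean, hemp⟩ :=
    exists_empirical_approx ν hν_int hν_mean (show 0 < γ / 10 by positivity)
  have hk' : (0 : ℝ) < k := Nat.cast_pos.2 hk
  obtain ⟨n, ⟨hna, hnR⟩, hn⟩ : ∃ n, (30 / γ ≤ a n ∧ R * (a n / n) ≤ γ / 4) ∧ 0 < n := by
    have h1 : Tendsto (fun n => R * (a n / n)) atTop (𝓝 0) := by
      simpa using ha_small.const_mul R
    exact (((ha_top.eventually_ge_atTop _).and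
      (h1.eventually_le_const (by positivity))).and (eventually_gt_atTop 0)).exists
  have hn' : (0 : ℝ) < n := Nat.cast_pos.2 hn
  have han := ha_pos n
  obtain ⟨Q, hQ⟩ := exists_nat_gt (10 / γ)
  have hQ' : (0 : ℝ) < Q := lt_trans (by positivity) hQ
  have hQ0 : 0 < Q := Nat.cast_pos.1 hQ'
  set M := n * Q with hM
  have hM0 : 0 < M := Nat.mul_pos hn hQ0
  have hM' : (M : ℝ) = n * Q := by rw [hM]; push_cast; ring
  have hM0' : (0 : ℝ) < M := Nat.cast_pos.2 hM0
  set p := k * M with hp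
  have hp0 : 0 < p := Nat.mul_pos hk hM0
  have hp' : (p : ℝ) = k * M := by rw [hp]; push_cast; ring
  have hp0' : (0 : ℝ) < p := Nat.cast_pos.2 hp0
  have hQγ : 1 / (Q : ℝ) ≤ γ / 10 := by
    rw [div_le_iff₀ hQ']
    rw [div_lt_iff₀ hγ0] at hQ
    linarith
  have hnp : (n : ℝ) ≤ p := by
    have h1 : (1 : ℝ) ≤ k := by exact_mod_cast hk
    have h2 : (1 : ℝ) ≤ Q := by exact_mod_cast hQ0
    rw [hp', hM']
    nlinarith [mul_le_mul h1 h2 zero_le_one hk'.le]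
  have hpγ : 1 / (p : ℝ) ≤ γ / 10 := by
    refine le_trans (one_div_le_one_div_of_le hQ' ?_) hQγ
    have h1 : (1 : ℝ) ≤ k := by exact_mod_cast hk
    have h2 : (1 : ℝ) ≤ n := by exact_mod_cast hn
    rw [hp', hM']
    nlinarith [mul_le_mul h1 h2 zero_le_one hk'.le]
  obtain ⟨n₂, hn₂a, hn₂p⟩ : ∃ n₂, (p + 1) / ε' ≤ a n₂ ∧ p + 1 ≤ n₂ :=
    ((ha_top.eventually_ge_atTop _).and (eventually_ge_atTop (p + 1))).exists
  have hn₂' : (1 : ℝ) ≤ n₂ := by exact_mod_cast (by omega : 1 ≤ n₂)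
  have hnn₂ : n < n₂ := by
    have : n ≤ p := by exact_mod_cast hnp
    omega
  set β : ℝ := min (γ / 10) ε' with hβ
  have hβ0 : 0 < β := lt_min (by positivity) hε'
  have hβγ : β ≤ γ / 10 := min_le_left _ _
  have hβε : β ≤ ε' := min_le_right _ _
  obtain ⟨c, hc, hcp, hcδ⟩ := exists_measurable_clock hT haper hp0
    (show 0 < β / n₂ ^ 2 by positivity)
  set E := clockGoodSet T c p n₂ with hE
  have hEθ : n₂ * μ.real Eᶜ ≤ β := by
    have h := measureReal_compl_clockGoodSet_le hT hc hcδ n₂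
    calc _ ≤ n₂ * (n₂ * (β / n₂ ^ 2)) := by gcongr
      _ = β := by field_simp
  set θ := μ.real Eᶜ with hθ
  have hθ0 : 0 ≤ θ := measureReal_nonneg
  have hθβ : θ ≤ β := by nlinarith
  have hunif : ∀ J : Set ℕ, _ := abs_measureReal_clock_sub_le (n := n₂) hT hc hp0 hcp (by omega)
  rw [← hE, ← hθ] at hunif
  have hiter : ∀ x ∈ E, ∀ i ≤ n₂, c (T^[i] x) = (c x + i) % p := fun x hx =>
    clock_iterate_of_mem_goodSet hcp hx
  let d : ℕ → ℝ := fun j => γ / 2 + y j * (a n / n)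
  have hd : ∀ j, γ / 4 ≤ d j ∧ d j ≤ 3 * γ / 4 := by
    intro j
    have h1 := abs_le.1 (hR j)
    have h2 : 0 < a n / n := by positivity
    have h3 : y j * (a n / n) ≤ R * (a n / n) := mul_le_mul_of_nonneg_right h1.2 h2.le
    have h4 : -R * (a n / n) ≤ y j * (a n / n) := mul_le_mul_of_nonneg_right h1.1 h2.le
    constructor <;> simp only [d] <;> linarith
  obtain ⟨W, hWloc, hWtot⟩ := exists_set_block_density (d := d)
    (fun j => by linarith [(hd j).1]) (fun j => by linarith [(hd j).2]) hM0
  set w : ℕ → ℝ := W.indicator fun _ => (1 : ℝ) with hw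
  have hw0 : ∀ i, 0 ≤ w i := fun i => indicator_nonneg (fun _ _ => zero_le_one) i
  have hw1 : ∀ i, w i ≤ 1 := fun i =>
    indicator_le_self' (f := fun _ : ℕ => (1 : ℝ)) (fun _ _ => zero_le_one) i
  set q : ℝ := (∑ i ∈ Finset.range p, w i) / p with hq
  set A : Set Ω := c ⁻¹' W with hA
  have hAm : MeasurableSet A := hc W.to_countable.measurableSet
  have hAq : |μ.real A - q| ≤ θ := hunif W
  have hdsum : (∑ j ∈ Finset.range k, d j) / k
      = γ / 2 + (∑ j ∈ Finset.range k, y j) / k * (a n / n) := by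
    simp only [d]
    rw [Finset.sum_add_distrib, ← Finset.sum_mul]
    simp only [Finset.sum_const, Finset.card_range, nsmul_eq_mul]
    field_simp
  have hqd : |q - (∑ j ∈ Finset.range k, d j) / k| ≤ 1 / p := by
    have h := hWtot k
    have h2 : q - (∑ j ∈ Finset.range k, d j) / k
        = (∑ i ∈ Finset.range (k * M), w i - M * ∑ j ∈ Finset.range k, d j) / p := by
      rw [hq, hp']
      field_simp
      rw [hp]
    rw [h2, abs_div, abs_of_pos hp0']
    exact div_le_div_of_nonneg_right h hp0'.le
  set b := (∑ j ∈ Finset.range k, y j) / k with hb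
  have hmeanA : |n * (γ / 2) + a n * b - n * μ.real A| ≤ 2 := by
    have h1 := abs_le.1 hAq
    have h2 := abs_le.1 hqd
    rw [hdsum] at h2
    have h3 : n * (γ / 2) + a n * b - n * μ.real A
        = n * (γ / 2 + b * (a n / n) - μ.real A) := by field_simp
    have h4 : |γ / 2 + b * (a n / n) - μ.real A| ≤ θ + 1 / p := by
      rw [abs_le]
      constructor <;> linarith
    have h5 : n * (1 / (p : ℝ)) ≤ 1 := by
      rw [mul_one_div, div_le_one hp0']
      exact hnp
    have h6 : (n : ℝ) * θ ≤ n₂ * θ :=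
      mul_le_mul_of_nonneg_right (by exact_mod_cast hnn₂.le) hθ0
    rw [h3, abs_mul, abs_of_pos hn']
    have h7 := mul_le_mul_of_nonneg_left h4 hn'.le
    linarith
  have hsum : ∀ m x, ∑ i ∈ Finset.range m,
      (A.indicator (fun _ => (1 : ℝ)) (T^[i] x) - (μ A).toReal)
        = ∑ i ∈ Finset.range m, w (c (T^[i] x)) - m * μ.real A := by
    intro m x
    rw [Finset.sum_sub_distrib, Finset.sum_const, Finset.card_range, nsmul_eq_mul]
    rfl
  have hXm : ∀ m, Measurable fun x => (a m)⁻¹ * ∑ i ∈ Finset.range m,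
      (A.indicator (fun _ => (1 : ℝ)) (T^[i] x) - (μ A).toReal) := fun m =>
    (Finset.measurable_sum _ fun i _ => (((measurable_const.indicator hAm).comp
      (hT.iterate i).measurable).sub_const _)).const_mul _
  refine ⟨A, n, n₂, hAm, hn, hnn₂, ?_, ?_, ?_⟩
  · rw [← ofReal_measureReal]
    refine ENNReal.ofReal_le_ofReal ?_
    have h1 : (∑ j ∈ Finset.range k, d j) / k ≤ 3 * γ / 4 := by
      rw [div_le_iff₀ hk']
      have := Finset.sum_le_sum (s := Finset.range k) fun j _ => (hd j).2
      rw [Finset.sum_const, Finset.card_range, nsmul_eq_mul] at this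
      linarith
    have h2 := abs_le.1 hAq
    have h3 := abs_le.1 hqd
    linarith
  · let D : Set ℕ := {s | M < s % M + n}
    have hD : μ.real (c ⁻¹' D) ≤ γ / 10 + θ := by
      have h1 := abs_le.1 (hunif D)
      have h2 : (∑ i ∈ Finset.range p, D.indicator (fun _ => (1 : ℝ)) i) / p ≤ 1 / Q := by
        rw [div_le_iff₀ hp0']
        refine (sum_indicator_near_block_end_le n k M).trans (le_of_eq ?_)
        rw [hp', hM']
        field_simp
      linarith
    have hY : ∀ t, |μ.real {x | y (c x / M) ≤ t}
        - (∑ j ∈ Finset.range k, (Iic t).indicator (fun _ => (1 : ℝ)) (y j)) / k| ≤ θ := by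
      intro t
      have h1 := hunif ((· / M) ⁻¹' (y ⁻¹' Iic t))
      have h2 : (∑ i ∈ Finset.range p,
          ((· / M) ⁻¹' (y ⁻¹' Iic t)).indicator (fun _ => (1 : ℝ)) i) / p
            = (∑ j ∈ Finset.range k, (Iic t).indicator (fun _ => (1 : ℝ)) (y j)) / k := by
        rw [hp, sum_indicator_preimage_div hM0, ← hp, hp']
        rw [mul_comm (k : ℝ), mul_div_mul_left _ _ hM0'.ne']
        rfl
      rw [h2] at h1
      exact h1
    refine levyDist_map_le_of_approx (Y := fun x => y (c x / M)) (hXm n) (s := Eᶜ ∪ c ⁻¹' D)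
      (κ := 3 * (γ / 10)) (η := 2 * (γ / 10)) ?_ ?_ ?_ ?_ hε (by linarith)
    · have := measureReal_union_le (μ := μ) Eᶜ (c ⁻¹' D)
      linarith
    · intro x hx
      simp only [mem_union, mem_compl_iff, not_or, not_not] at hx
      obtain ⟨hxE, hxD⟩ := hx
      have hxD' : c x % M + n ≤ M := not_lt.1 hxD
      rw [hsum]
      have h1 : ∀ i ∈ Finset.range n, w (c (T^[i] x)) = w (c x + i) := by
        intro i hi
        have hi' := Finset.mem_range.1 hi
        rw [hiter x hxE i (by omega), Nat.mod_eq_of_lt]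
        have h2 : c x / M < k := (Nat.div_lt_iff_lt_mul hM0).2 (hcp x)
        have h3 := Nat.div_add_mod (c x) M
        have h4 : M * (c x / M + 1) ≤ M * k := Nat.mul_le_mul_left M h2
        rw [Nat.mul_comm M k, ← hp] at h4
        rw [Nat.mul_add, Nat.mul_one] at h4
        omega
      rw [Finset.sum_congr rfl h1]
      have h2 := abs_le.1 (hWloc (c x) n hxD')
      set S := ∑ i ∈ Finset.range n, w (c x + i)
      have h3 : n * d (c x / M) = n * (γ / 2) + a n * y (c x / M) := by
        simp only [d]
        field_simp
      have h4 := abs_le.1 hmean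
      have h5 : |n * (γ / 2) + a n * b - n * μ.real A| ≤ 2 := hmeanA
      have h6 := abs_le.1 h5
      have h7 : 30 ≤ a n * γ := (div_le_iff₀ hγ0).1 hna
      have h8 : a n * b ≤ a n * (γ / 10) := mul_le_mul_of_nonneg_left h4.2 han.le
      have h9 : a n * (-(γ / 10)) ≤ a n * b := mul_le_mul_of_nonneg_left h4.1 han.le
      have h10 : (a n)⁻¹ * (S - n * μ.real A) - y (c x / M)
          = (S - n * μ.real A - a n * y (c x / M)) / a n := by field_simp
      rw [h10, abs_div, abs_of_pos han, div_le_iff₀ han, abs_le]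
      constructor <;> linarith
    · intro t
      have h1 := abs_le.1 (hY t)
      have h2 := (hemp t).1
      have h3 : ν.real (Iic (t + γ / 10)) ≤ ν.real (Iic (t + 2 * (γ / 10))) :=
        measureReal_mono (Iic_subset_Iic.2 (by linarith))
      linarith
    · intro t
      have h1 := abs_le.1 (hY t)
      have h2 := (hemp t).2
      have h3 : ν.real (Iic (t - 2 * (γ / 10))) ≤ ν.real (Iic (t - γ / 10)) :=
        measureReal_mono (Iic_subset_Iic.2 (by linarith))
      linarith
  · have hY : ∀ t : ℝ, μ.real {_x : Ω | (0 : ℝ) ≤ t} = (Measure.dirac (0 : ℝ)).real (Iic t) := by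
      intro t
      by_cases ht : 0 ≤ t
      · simp [ht, measureReal_def]
      · simp [ht, measureReal_def]
    refine levyDist_map_le_of_approx (Y := fun _ => 0) (hXm n₂) (s := Eᶜ) (κ := ε') (η := 0)
      (by linarith) ?_ (fun t => by rw [hY]; simp) (fun t => by rw [hY]; simp) hε' (by linarith)
    intro x hx
    have hxE : x ∈ E := not_not.1 hx
    have h1 : ∀ i ∈ Finset.range n₂, w (c (T^[i] x)) = w ((c x + i) % p) := fun i hi => by
      rw [hiter x hxE i (Finset.mem_range.1 hi).le]
    rw [hsum, Finset.sum_congr rfl h1, sub_zero]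
    have h2 := abs_le.1 (abs_sum_mod_sub_le hw0 hw1 hp0 n₂ (c x))
    rw [← hq] at h2
    have h3 := abs_le.1 hAq
    have h4 : p + 1 ≤ a n₂ * ε' := (div_le_iff₀ hε').1 hn₂a
    have ha₂ := ha_pos n₂
    rw [abs_mul, abs_of_pos (inv_pos.2 ha₂), inv_mul_le_iff₀ ha₂, abs_le]
    constructor <;> nlinarith
end

section
/- Let (Ω, 𝒜, μ, T) be an aperiodic dynamical system on a standard Borel probability space and (aₙ) an increasing sequence of positive reals with aₙ → ∞ and aₙ/n → 0. Let ν be a zero-mean Borel probability measure on ℝ, let ε > 0, and let (δ_k)_{k≥2} be any sequence of positive reals. Then there exist a measurable set A and a strictly increasing sequence of positive integers (n_k)_{k≥1} such that μ(A) ≤ ε, d(ℒ((1/a_{n₁}) S_{n₁}(1_A − μ(A))), ν) ≤ ε, and for every k ≥ 2, d(ℒ((1/a_{n_k}) S_{n_k}(1_A − μ(A))), δ₀) ≤ δ_k, where d is the Lévy metric and δ₀ is the Dirac measure at 0. -/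
open MeasureTheory Filter Topology Set

/-- The first `N` iterates of `T` carry `B` to pairwise disjoint sets, injectively. -/
def IsTower {Ω : Type*} (T : Ω → Ω) (N : ℕ) (B : Set Ω) : Prop :=
  ∀ i < N, ∀ j < N, ∀ x ∈ B, ∀ y ∈ B, T^[i] x = T^[j] y → i = j ∧ x = y

/-- The union of the first `N` iterates of `B`. -/
def tower {Ω : Type*} (T : Ω → Ω) (N : ℕ) (B : Set Ω) : Set Ω :=
  ⋃ i ∈ Finset.range N, T^[i] '' B

theorem mem_tower {Ω : Type*} {T : Ω → Ω} {N : ℕ} {B : Set Ω} {y : Ω} :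
    y ∈ tower T N B ↔ ∃ i < N, ∃ x ∈ B, T^[i] x = y := by
  simp [tower]

theorem exists_seq_separating_finite (Ω : Type*) [MeasurableSpace Ω] [StandardBorelSpace Ω] :
    ∃ U : ℕ → Set Ω, (∀ k, MeasurableSet (U k)) ∧
      ∀ (x : Ω) (s : Set Ω), s.Finite → x ∉ s → ∃ k, x ∈ U k ∧ Disjoint (U k) s := by
  let := upgradeStandardBorel Ω
  obtain ⟨b, hbc, hbe, hb⟩ := TopologicalSpace.exists_countable_basis Ω
  obtain hΩ | ⟨⟨x0⟩⟩ := isEmpty_or_nonempty Ω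
  · exact ⟨fun _ => ∅, fun _ => MeasurableSet.empty, fun x => hΩ.elim x⟩
  have hne : b.Nonempty := by
    obtain ⟨v, hv, -⟩ := hb.exists_subset_of_mem_open (mem_univ x0) isOpen_univ
    exact ⟨v, hv⟩
  obtain ⟨U, hU⟩ := hbc.exists_eq_range hne
  refine ⟨U, fun k => (hb.isOpen (hU ▸ mem_range_self k)).measurableSet, fun x s hs hx => ?_⟩
  obtain ⟨v, hv, hxv, hvs⟩ := hb.exists_subset_of_mem_open (a := x) (u := sᶜ) hx
    hs.isClosed.isOpen_compl
  rw [hU] at hv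
  obtain ⟨k, rfl⟩ := hv
  exact ⟨k, hxv, disjoint_left.2 fun y hy => hvs hy⟩

section Tower

variable {Ω : Type*} [MeasurableSpace Ω] [StandardBorelSpace Ω]

theorem measurableSet_iterate_image {T : Ω → Ω} (hT : Measurable T)
    (hinj : Function.Injective T) (i : ℕ) {B : Set Ω} (hB : MeasurableSet B) :
    MeasurableSet (T^[i] '' B) :=
  ((hT.iterate i).measurableEmbedding (hinj.iterate i)).measurableSet_image.2 hB

theorem measure_iterate_image {μ : Measure Ω} {T : Ω → Ω} (hT : MeasurePreserving T μ μ)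
    (hinj : Function.Injective T) (i : ℕ) {B : Set Ω} (hB : MeasurableSet B) :
    μ (T^[i] '' B) = μ B := by
  rw [← (hT.iterate i).measure_preimage
    (measurableSet_iterate_image hT.measurable hinj i hB).nullMeasurableSet,
    (hinj.iterate i).preimage_image]

theorem measurableSet_tower {T : Ω → Ω} (hT : Measurable T)
    (hinj : Function.Injective T) (N : ℕ) {B : Set Ω} (hB : MeasurableSet B) :
    MeasurableSet (tower T N B) :=
  Finset.measurableSet_biUnion _ fun i _ => measurableSet_iterate_image hT hinj i hB

/-- A measurable set with gaps at least `n` along every orbit which every aperiodic orbit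
visits. -/
theorem exists_sparse_sweeping {T : Ω → Ω} (hT : Measurable T)
    (hinj : Function.Injective T) (n : ℕ) :
    ∃ C : Set Ω, MeasurableSet C ∧ (∀ i, 1 ≤ i → i < n → ∀ x ∈ C, T^[i] x ∉ C) ∧
      ∀ x, (∀ m ≥ 1, T^[m] x ≠ x) → ∃ i, T^[i] x ∈ C := by
  obtain ⟨U, hUm, hU⟩ := exists_seq_separating_finite Ω
  let F : ℕ → Set Ω := fun k => U k \ ⋃ i ∈ Finset.Ico 1 n, T^[i] ⁻¹' (U k)
  have hFm : ∀ k, MeasurableSet (F k) := fun k =>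
    (hUm k).diff (Finset.measurableSet_biUnion _ fun i _ => hT.iterate i (hUm k))
  have hF : ∀ k i, 1 ≤ i → i < n → ∀ x ∈ F k, T^[i] x ∉ F k := by
    intro k i h1 h2 x hx hx'
    exact hx.2 (mem_biUnion (x := i) (by simp [h1, h2]) hx'.1)
  have hFcov : ∀ x, (∀ m ≥ 1, T^[m] x ≠ x) → ∃ k, x ∈ F k := by
    intro x hx
    obtain ⟨k, hk, hd⟩ := hU x ((fun i => T^[i] x) '' (Finset.Ico 1 n : Set ℕ))
      ((Finset.finite_toSet _).image _) (by
        rintro ⟨i, hi, h⟩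
        simp only [Finset.coe_Ico, mem_Ico] at hi
        exact hx i hi.1 h)
    refine ⟨k, hk, fun h => ?_⟩
    simp only [mem_iUnion, mem_preimage] at h
    obtain ⟨i, hi, h⟩ := h
    exact disjoint_left.1 hd h ⟨i, hi, rfl⟩
  let G : ℕ → Set Ω := fun k => Nat.rec ∅ (fun k G => G ∪ (F k \
    ((⋃ i ∈ Finset.range n, T^[i] ⁻¹' G) ∪ ⋃ i ∈ Finset.range n, T^[i] '' G))) k
  have hGs : ∀ k, G (k + 1) = G k ∪ (F k \
    ((⋃ i ∈ Finset.range n, T^[i] ⁻¹' G k) ∪ ⋃ i ∈ Finset.range n, T^[i] '' G k)) :=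
    fun k => rfl
  have hGm : ∀ k, MeasurableSet (G k) := by
    intro k
    induction k with
    | zero => exact MeasurableSet.empty
    | succ k ih =>
      rw [hGs]
      exact ih.union ((hFm k).diff ((Finset.measurableSet_biUnion _ fun i _ =>
        hT.iterate i ih).union (Finset.measurableSet_biUnion _ fun i _ =>
        measurableSet_iterate_image hT hinj i ih)))
  have hGmono : Monotone G := monotone_nat_of_le_succ fun k => by
    rw [hGs]; exact subset_union_left
  have hGi : ∀ k i, 1 ≤ i → i < n → ∀ x ∈ G k, T^[i] x ∉ G k := by
    intro k
    induction k with
    | zero => intro i _ _ x hx; exact hx.elim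
    | succ k ih =>
      intro i h1 h2 x hx hx'
      rw [hGs] at hx hx'
      rcases hx with hx | hx <;> rcases hx' with hx' | hx'
      · exact ih i h1 h2 x hx hx'
      · exact hx'.2 (Or.inr (mem_biUnion (x := i) (by simp [h2]) ⟨x, hx, rfl⟩))
      · exact hx.2 (Or.inl (mem_biUnion (x := i) (by simp [h2]) hx'))
      · exact hF k i h1 h2 x hx.1 hx'.1
  refine ⟨⋃ k, G k, MeasurableSet.iUnion hGm, ?_, ?_⟩
  · intro i h1 h2 x hx hx'
    rw [mem_iUnion] at hx hx'
    obtain ⟨k, hk⟩ := hx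
    obtain ⟨l, hl⟩ := hx'
    exact hGi (max k l) i h1 h2 x (hGmono (le_max_left _ _) hk) (hGmono (le_max_right _ _) hl)
  · intro x hx
    have hx' : ∀ m ≥ 1, T^[m] (T^[n] x) ≠ T^[n] x := by
      intro m hm h
      rw [← Function.iterate_add_apply, add_comm, Function.iterate_add_apply] at h
      exact hx m hm (hinj.iterate n h)
    obtain ⟨k, hk⟩ := hFcov _ hx'
    rcases Classical.em (T^[n] x ∈ G (k + 1)) with h | h
    · exact ⟨n, mem_iUnion.2 ⟨k + 1, h⟩⟩
    · rw [hGs] at h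
      have h2 : T^[n] x ∈ ((⋃ i ∈ Finset.range n, T^[i] ⁻¹' G k) ∪
          ⋃ i ∈ Finset.range n, T^[i] '' G k) := by
        by_contra h3
        exact h (Or.inr ⟨hk, h3⟩)
      rcases h2 with h2 | h2
      · simp only [mem_iUnion, mem_preimage] at h2
        obtain ⟨i, -, h2⟩ := h2
        rw [← Function.iterate_add_apply] at h2
        exact ⟨_, mem_iUnion.2 ⟨_, h2⟩⟩
      · simp only [mem_iUnion, mem_image, Finset.mem_range] at h2
        obtain ⟨i, hi, y, hy, h2⟩ := h2
        refine ⟨n - i, mem_iUnion.2 ⟨k, ?_⟩⟩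
        have : T^[i] y = T^[i] (T^[n - i] x) := by
          rw [h2, ← Function.iterate_add_apply]; congr 2; omega
        rwa [← hinj.iterate i this]

/-- The Rokhlin lemma for aperiodic transformations. -/
theorem exists_tower {μ : Measure Ω} [IsProbabilityMeasure μ] {T : Ω → Ω}
    (hT : MeasurePreserving T μ μ) (hTbij : Function.Bijective T)
    (haper : μ {x | ∃ n ≥ 1, T^[n] x = x} = 0) {N : ℕ} (hN : 1 ≤ N) {η : ℝ} (hη : 0 < η) :
    ∃ B : Set Ω, MeasurableSet B ∧ IsTower T N B ∧ μ.real (tower T N B)ᶜ ≤ η := by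
  have hinj := hTbij.injective
  obtain ⟨n, hn⟩ := exists_nat_ge (N / η)
  have hn1 : 1 ≤ n := by
    have : 0 < N / η := by positivity
    exact_mod_cast (show (0 : ℝ) < n by linarith)
  obtain ⟨C, hC, hCi, hCs⟩ := exists_sparse_sweeping hT.measurable hinj n
  have hCμ : n * μ.real C ≤ 1 := by
    have h : μ.real (⋃ i ∈ Finset.range n, T^[i] ⁻¹' C) = n * μ.real C := by
      rw [measureReal_biUnion_finset]
      · simp_rw [fun i => (hT.iterate i).measureReal_preimage hC.nullMeasurableSet]
        simp
      · have key : ∀ i j, i < j → j < n → Disjoint (T^[i] ⁻¹' C) (T^[j] ⁻¹' C) := by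
          intro i j hij hj
          rw [disjoint_left]
          intro x hx hx'
          refine hCi (j - i) (by omega) (by omega) _ hx ?_
          rw [← Function.iterate_add_apply, Nat.sub_add_cancel hij.le]
          exact hx'
        intro i hi j hj hij
        simp only [Finset.coe_range, mem_Iio] at hi hj
        rcases lt_or_gt_of_ne hij with h | h
        · exact key i j h hj
        · exact (key j i h hi).symm
      · exact fun i _ => hT.measurable.iterate i hC
    rw [← h]
    exact measureReal_le_one
  let H : ℕ → Set Ω := fun s => {x | T^[s] x ∈ C ∧ ∀ i < s, T^[i] x ∉ C}
  have hHm : ∀ s, MeasurableSet (H s) := by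
    intro s
    have : H s = T^[s] ⁻¹' C \ ⋃ i ∈ Finset.range s, T^[i] ⁻¹' C := by
      ext x; simp [H]
    rw [this]
    exact (hT.measurable.iterate s hC).diff
      (Finset.measurableSet_biUnion _ fun i _ => hT.measurable.iterate i hC)
  have hHd : ∀ s t x, x ∈ H s → x ∈ H t → s = t := by
    intro s t x hs ht
    rcases lt_trichotomy s t with h | h | h
    · exact (ht.2 s h hs.1).elim
    · exact h
    · exact (hs.2 t h ht.1).elim
  have hHs : ∀ s i x, i ≤ s → x ∈ H s → T^[i] x ∈ H (s - i) := by
    intro s i x hi hx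
    refine ⟨?_, fun j hj => ?_⟩
    · rw [← Function.iterate_add_apply, Nat.sub_add_cancel hi]; exact hx.1
    · rw [← Function.iterate_add_apply]; exact hx.2 _ (by omega)
  refine ⟨⋃ q : ℕ, H ((q + 1) * N), MeasurableSet.iUnion fun q => hHm _, ?_, ?_⟩
  · intro i hi j hj x hx y hy hxy
    rw [mem_iUnion] at hx hy
    obtain ⟨p, hp⟩ := hx
    obtain ⟨q, hq⟩ := hy
    have hp' : N ≤ (p + 1) * N := Nat.le_mul_of_pos_left N (by omega)
    have hq' : N ≤ (q + 1) * N := Nat.le_mul_of_pos_left N (by omega)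
    have h1 := hHs _ i x (by omega) hp
    have h2 := hHs _ j y (by omega) hq
    rw [hxy] at h1
    have h3 := hHd _ _ _ h1 h2
    have h4 : (p + 1) * N + j = (q + 1) * N + i := by omega
    have h5 : j % N = i % N := by
      have := congrArg (· % N) h4
      simpa [Nat.mul_add_mod'] using this
    rw [Nat.mod_eq_of_lt hj, Nat.mod_eq_of_lt hi] at h5
    subst h5
    exact ⟨rfl, hinj.iterate _ hxy⟩
  · have hsub : (tower T N (⋃ q : ℕ, H ((q + 1) * N)))ᶜ ⊆
        {x | ∃ n ≥ 1, T^[n] x = x} ∪ ⋃ i ∈ Finset.range N, T^[i] '' C := by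
      intro z hz
      by_contra hcon
      simp only [mem_union, mem_ofPred_eq, mem_iUnion, Finset.mem_range, not_or, not_exists,
        not_and] at hcon
      obtain ⟨hzp, hzC⟩ := hcon
      have hex := hCs z hzp
      classical
      have hs : z ∈ H (Nat.find hex) := ⟨Nat.find_spec hex, fun i hi => Nat.find_min hex hi⟩
      generalize Nat.find hex = s at hs
      have hs1 : s ≠ 0 := by
        rintro rfl
        exact hzC 0 (by omega) ⟨z, hs.1, rfl⟩
      have hdvd : N ∣ s + (N - s % N) % N := by
        rw [Nat.dvd_iff_mod_eq_zero]
        have := Nat.mod_lt s (show 0 < N by omega)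
        rcases Nat.eq_zero_or_pos (s % N) with h | h
        · simp [h]
        · rw [Nat.mod_eq_of_lt (show N - s % N < N by omega), Nat.add_mod,
            Nat.mod_eq_of_lt (show N - s % N < N by omega), Nat.add_sub_cancel' this.le,
            Nat.mod_self]
      have hiN : (N - s % N) % N < N := Nat.mod_lt _ (by omega)
      generalize (N - s % N) % N = i at hdvd hiN
      obtain ⟨x, rfl⟩ := hTbij.surjective.iterate i z
      apply hz
      refine mem_tower.2 ⟨i, hiN, x, ?_, rfl⟩
      obtain ⟨q, hq⟩ := hdvd
      obtain ⟨q, rfl⟩ : ∃ r, q = r + 1 := Nat.exists_eq_succ_of_ne_zero (by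
        rintro rfl; omega)
      refine mem_iUnion.2 ⟨q, ?_⟩
      rw [mul_comm, ← hq]
      refine ⟨by rw [Function.iterate_add_apply]; exact hs.1, fun j hj hjC => ?_⟩
      rcases lt_or_ge j i with hji | hji
      · refine hzC (i - j) (by omega) ⟨_, hjC, ?_⟩
        rw [← Function.iterate_add_apply]; congr 2; omega
      · refine hs.2 (j - i) (by omega) ?_
        rwa [← Function.iterate_add_apply, Nat.sub_add_cancel hji]
    calc μ.real (tower T N (⋃ q : ℕ, H ((q + 1) * N)))ᶜ
        ≤ μ.real ({x | ∃ n ≥ 1, T^[n] x = x} ∪ ⋃ i ∈ Finset.range N, T^[i] '' C) :=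
          measureReal_mono hsub
      _ ≤ μ.real {x | ∃ n ≥ 1, T^[n] x = x} + μ.real (⋃ i ∈ Finset.range N, T^[i] '' C) :=
          measureReal_union_le _ _
      _ ≤ 0 + ∑ i ∈ Finset.range N, μ.real (T^[i] '' C) := by
          gcongr
          · simp [measureReal_def, haper]
          · exact measureReal_biUnion_finset_le _ _
      _ = N * μ.real C := by
          simp [measureReal_def, measure_iterate_image hT hinj _ hC]
      _ ≤ η := by
          rw [div_le_iff₀ hη] at hn
          have h0 : (0 : ℝ) ≤ μ.real C := measureReal_nonneg
          have hn0 : (0 : ℝ) < n := by exact_mod_cast hn1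
          nlinarith

end Tower

/-- The number of visits to `A` during the first `n` steps of the orbit of `x`. -/
noncomputable def visits {Ω : Type*} (T : Ω → Ω) (A : Set Ω) (n : ℕ) (x : Ω) : ℝ :=
  ∑ i ∈ Finset.range n, A.indicator (fun _ => (1 : ℝ)) (T^[i] x)

/-- Up to an error set of measure at most `η`, the function `1_A - c` is the coboundary of a
function bounded by `K`. -/
structure IsAlmostCoboundary {Ω : Type*} [MeasurableSpace Ω] (μ : Measure Ω) (T : Ω → Ω)
    (c : ℝ) (A : Set Ω) (K η : ℝ) : Prop where
  measurableSet : MeasurableSet A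
  measure_close : |μ.real A - c| ≤ η
  exists_transfer : ∃ (g : Ω → ℝ) (E : Set Ω), MeasurableSet E ∧ μ.real E ≤ η ∧
    (∀ x, |g x| ≤ K) ∧ ∀ x ∉ E, A.indicator (fun _ => (1 : ℝ)) x - c = g x - g (T x)

theorem indicator_one_mem_Icc {Ω : Type*} (A : Set Ω) (x : Ω) :
    A.indicator (fun _ => (1 : ℝ)) x ∈ Icc (0 : ℝ) 1 := by
  rcases Classical.em (x ∈ A) with h | h <;> simp [h]

theorem visits_nonneg {Ω : Type*} (T : Ω → Ω) (A : Set Ω) (n : ℕ) (x : Ω) :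
    0 ≤ visits T A n x :=
  Finset.sum_nonneg fun _ _ => (indicator_one_mem_Icc A _).1

theorem abs_visits_sub_le_of_transfer {Ω : Type*} {T : Ω → Ω} {A E : Set Ω} {c K : ℝ}
    (hc : c ∈ Icc (0 : ℝ) 1) {g : Ω → ℝ} (hg : ∀ x, |g x| ≤ K)
    (h : ∀ x ∉ E, A.indicator (fun _ => (1 : ℝ)) x - c = g x - g (T x)) (n : ℕ) (x : Ω) :
    |visits T A n x - n * c| ≤ 2 * K + (1 + 2 * K) * visits T E n x := by
  have hpt : ∀ y, |A.indicator (fun _ => (1 : ℝ)) y - c - (g y - g (T y))| ≤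
      (1 + 2 * K) * E.indicator (fun _ => (1 : ℝ)) y := by
    intro y
    rcases Classical.em (y ∈ E) with hy | hy
    · have h1 := indicator_one_mem_Icc A y
      have h2 := abs_le.1 (hg y)
      have h3 := abs_le.1 (hg (T y))
      simp only [hy, indicator_of_mem, mul_one]
      rw [abs_le]
      constructor <;> linarith [h1.1, h1.2, hc.1, hc.2, h2.1, h2.2, h3.1, h3.2]
    · simp [hy, h y hy]
  have htel : ∑ i ∈ Finset.range n, (g (T^[i] x) - g (T (T^[i] x))) = g x - g (T^[n] x) := by
    simp_rw [← Function.iterate_succ_apply' T]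
    exact Finset.sum_range_sub' (fun i => g (T^[i] x)) n
  have hdec : visits T A n x - n * c = (g x - g (T^[n] x)) + ∑ i ∈ Finset.range n,
      (A.indicator (fun _ => (1 : ℝ)) (T^[i] x) - c - (g (T^[i] x) - g (T (T^[i] x)))) := by
    rw [Finset.sum_sub_distrib, htel, Finset.sum_sub_distrib, visits]
    simp
  have hsum : |∑ i ∈ Finset.range n,
      (A.indicator (fun _ => (1 : ℝ)) (T^[i] x) - c - (g (T^[i] x) - g (T (T^[i] x))))| ≤
      (1 + 2 * K) * visits T E n x := by
    rw [visits, Finset.mul_sum]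
    exact (Finset.abs_sum_le_sum_abs _ _).trans (Finset.sum_le_sum fun i _ => hpt _)
  have h2 := abs_le.1 (hg x)
  have h3 := abs_le.1 (hg (T^[n] x))
  rw [hdec]
  rw [abs_le] at hsum ⊢
  constructor <;> linarith [hsum.1, hsum.2, h2.1, h2.2, h3.1, h3.2]

theorem measurable_visits {Ω : Type*} [MeasurableSpace Ω] {T : Ω → Ω} (hT : Measurable T)
    {A : Set Ω} (hA : MeasurableSet A) (n : ℕ) :
    Measurable (visits T A n) := by
  unfold visits
  exact Finset.measurable_sum _ fun i _ =>
    (measurable_const.indicator hA).comp (hT.iterate i)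

theorem visits_le {Ω : Type*} (T : Ω → Ω) (A : Set Ω) (n : ℕ) (x : Ω) : visits T A n x ≤ n := by
  have := Finset.sum_le_card_nsmul (Finset.range n)
    (fun i => A.indicator (fun _ => (1 : ℝ)) (T^[i] x)) 1
    fun i _ => (indicator_one_mem_Icc A _).2
  simpa [visits] using this

theorem integrable_visits {Ω : Type*} [MeasurableSpace Ω] {μ : Measure Ω}
    [IsFiniteMeasure μ] {T : Ω → Ω} (hT : Measurable T) {A : Set Ω} (hA : MeasurableSet A) (n : ℕ) :
    Integrable (visits T A n) μ :=
  Integrable.of_bound (measurable_visits hT hA n).aestronglyMeasurable n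
    (ae_of_all _ fun x => by
      rw [Real.norm_of_nonneg (visits_nonneg T A n x)]; exact visits_le T A n x)

section TowerVisits

variable {Ω : Type*} [MeasurableSpace Ω] [StandardBorelSpace Ω] {μ : Measure Ω}
  [IsProbabilityMeasure μ] {T : Ω → Ω}

theorem IsTower.measure_inter (hT : MeasurePreserving T μ μ) (hinj : Function.Injective T)
    {N : ℕ} {B : Set Ω} (hB : MeasurableSet B) (h : IsTower T N B) {S : Set Ω}
    (hS : MeasurableSet S) :
    μ.real (S ∩ tower T N B) = ∫ x in B, visits T S N x ∂μ := by
  have h1 : S ∩ tower T N B = ⋃ i ∈ Finset.range N, T^[i] '' (B ∩ T^[i] ⁻¹' S) := by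
    ext y
    simp only [tower, mem_inter_iff, mem_iUnion, mem_image, mem_preimage, Finset.mem_range]
    constructor
    · rintro ⟨hy, i, hi, x, hx, rfl⟩
      exact ⟨i, hi, x, ⟨hx, hy⟩, rfl⟩
    · rintro ⟨i, hi, x, ⟨hx, hy⟩, rfl⟩
      exact ⟨hy, i, hi, x, hx, rfl⟩
  have hm : ∀ i, MeasurableSet (B ∩ T^[i] ⁻¹' S) := fun i =>
    hB.inter (hT.measurable.iterate i hS)
  rw [h1, measureReal_biUnion_finset]
  · unfold visits
    rw [integral_finsetSum]
    · refine Finset.sum_congr rfl fun i _ => ?_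
      rw [measureReal_def, measure_iterate_image hT hinj i (hm i)]
      have h2 : (fun x => S.indicator (fun _ => (1 : ℝ)) (T^[i] x)) =
          (T^[i] ⁻¹' S).indicator (fun _ => 1) := by
        funext x
        rcases Classical.em (T^[i] x ∈ S) with h' | h'
        · rw [indicator_of_mem h', indicator_of_mem (show x ∈ T^[i] ⁻¹' S from h')]
        · rw [indicator_of_notMem h', indicator_of_notMem (show x ∉ T^[i] ⁻¹' S from h')]
      rw [h2, integral_indicator_const _ (hT.measurable.iterate i hS)]
      simp [measureReal_def, Measure.restrict_apply (hT.measurable.iterate i hS), inter_comm]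
    · intro i _
      exact ((hT.iterate i).integrable_comp_of_integrable
        ((integrable_const (1 : ℝ)).indicator hS)).integrableOn
  · intro i hi j hj hij
    simp only [Finset.coe_range, mem_Iio] at hi hj
    rw [Function.onFun, disjoint_left]
    rintro y ⟨x, hx, rfl⟩ ⟨x', hx', hxx⟩
    exact hij (h i hi j hj x hx.1 x' hx'.1 hxx.symm).1
  · exact fun i _ => measurableSet_iterate_image hT.measurable hinj i (hm i)

theorem IsTower.measure_tower (hT : MeasurePreserving T μ μ) (hinj : Function.Injective T)
    {N : ℕ} {B : Set Ω} (hB : MeasurableSet B) (h : IsTower T N B) :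
    μ.real (tower T N B) = N * μ.real B := by
  have := h.measure_inter hT hinj hB MeasurableSet.univ
  rw [univ_inter] at this
  rw [this]
  simp [visits, mul_comm]

theorem IsTower.mul_measure_le_one (hT : MeasurePreserving T μ μ) (hinj : Function.Injective T)
    {N : ℕ} {B : Set Ω} (hB : MeasurableSet B) (h : IsTower T N B) :
    N * μ.real B ≤ 1 := by
  rw [← h.measure_tower hT hinj hB]
  exact measureReal_le_one

omit [IsProbabilityMeasure μ] in
/-- A measurable set can be prescribed on the levels of a tower. -/
theorem IsTower.exists_prescribed (hT : MeasurePreserving T μ μ) (hinj : Function.Injective T)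
    {N : ℕ} {B : Set Ω} (hB : MeasurableSet B) (h : IsTower T N B) {A : Set Ω}
    (hA : MeasurableSet A) (p : Ω → ℕ → Prop) (hp : ∀ i, MeasurableSet {x | p x i}) :
    ∃ A' : Set Ω, MeasurableSet A' ∧ (∀ x ∈ B, ∀ i < N, T^[i] x ∈ A' ↔ p x i) ∧
      ∀ y ∉ tower T N B, y ∈ A' ↔ y ∈ A := by
  refine ⟨(A \ tower T N B) ∪ ⋃ i ∈ Finset.range N, T^[i] '' (B ∩ {x | p x i}), ?_, ?_, ?_⟩
  · exact (hA.diff (measurableSet_tower hT.measurable hinj N hB)).union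
      (Finset.measurableSet_biUnion _ fun i _ =>
        measurableSet_iterate_image hT.measurable hinj i (hB.inter (hp i)))
  · intro x hx i hi
    constructor
    · rintro (h1 | h1)
      · exact (h1.2 (mem_tower.2 ⟨i, hi, x, hx, rfl⟩)).elim
      · simp only [mem_iUnion, Finset.mem_range] at h1
        obtain ⟨j, hj, y, hy, hxy⟩ := h1
        obtain ⟨rfl, rfl⟩ := h j hj i hi y hy.1 x hx hxy
        exact hy.2
    · intro h1
      exact Or.inr (mem_biUnion (x := i) (by simpa using hi) ⟨x, ⟨hx, h1⟩, rfl⟩)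
  · intro y hy
    constructor
    · rintro (h1 | h1)
      · exact h1.1
      · simp only [mem_iUnion, Finset.mem_range] at h1
        obtain ⟨j, hj, z, hz, hzy⟩ := h1
        exact (hy (mem_tower.2 ⟨j, hj, z, hz.1, hzy⟩)).elim
    · exact fun h1 => Or.inl ⟨h1, hy⟩

theorem IsTower.isAlmostCoboundary (hT : MeasurePreserving T μ μ)
    (hinj : Function.Injective T) {N : ℕ} {B : Set Ω} (hB : MeasurableSet B)
    (h : IsTower T N B) {η : ℝ} (hη : μ.real (tower T N B)ᶜ ≤ η) {A : Set Ω}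
    (hA : MeasurableSet A) {c : ℝ} (hc : c ∈ Icc (0 : ℝ) 1)
    (hv : ∀ x ∈ B, visits T A N x = N * c) :
    IsAlmostCoboundary μ T c A N η := by
  have htm := measurableSet_tower hT.measurable hinj N hB
  refine ⟨hA, ?_, ?_⟩
  · have h1 : μ.real (A ∩ tower T N B) = c * μ.real (tower T N B) := by
      rw [h.measure_inter hT hinj hB hA, setIntegral_congr_fun hB hv,
        h.measure_tower hT hinj hB]
      simp; ring
    have h2 := measureReal_inter_add_sdiff (μ := μ) (s := A) htm
    have h3 : μ.real (tower T N B)ᶜ = 1 - μ.real (tower T N B) := probReal_compl_eq_one_sub htm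
    have h4 : μ.real (A \ tower T N B) ≤ μ.real (tower T N B)ᶜ :=
      measureReal_mono fun x hx => hx.2
    have h5 : 0 ≤ μ.real (A \ tower T N B) := measureReal_nonneg
    have h6 : 0 ≤ μ.real (tower T N B)ᶜ := measureReal_nonneg
    have h7 := hc.1
    have h8 := hc.2
    rw [abs_le]
    constructor <;> nlinarith
  · classical
    let f : Ω → ℝ := fun x => A.indicator (fun _ => (1 : ℝ)) x - c
    have hf : ∀ x, |f x| ≤ 1 := by
      intro x
      have h1 := indicator_one_mem_Icc A x
      rw [abs_le]
      constructor <;> simp only [f] <;> linarith [h1.1, h1.2, hc.1, hc.2]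
    let r : Ω → ℕ := fun y => if hy : ∃ i < N, ∃ x ∈ B, T^[i] x = y then N - hy.choose else 0
    have hr : ∀ i < N, ∀ x ∈ B, r (T^[i] x) = N - i := by
      intro i hi x hx
      have hy : ∃ j < N, ∃ x' ∈ B, T^[j] x' = T^[i] x := ⟨i, hi, x, hx, rfl⟩
      obtain ⟨h1, x', hx', h2⟩ := hy.choose_spec
      simp only [r, dif_pos hy]
      rw [(h _ h1 i hi x' hx' x hx h2).1]
    have hr0 : ∀ y ∉ tower T N B, r y = 0 := by
      intro y hy
      rw [mem_tower] at hy
      simp only [r, dif_neg hy]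
    refine ⟨fun y => ∑ j ∈ Finset.range (r y), f (T^[j] y), (tower T N B)ᶜ, htm.compl, hη,
      ?_, ?_⟩
    · intro y
      have h1 : r y ≤ N := by
        simp only [r]; split_ifs <;> omega
      calc |∑ j ∈ Finset.range (r y), f (T^[j] y)|
          ≤ ∑ j ∈ Finset.range (r y), |f (T^[j] y)| := Finset.abs_sum_le_sum_abs _ _
        _ ≤ ∑ j ∈ Finset.range (r y), (1 : ℝ) := Finset.sum_le_sum fun j _ => hf _
        _ = r y := by simp
        _ ≤ N := by exact_mod_cast h1
    · intro y hy
      rw [notMem_compl_iff, mem_tower] at hy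
      obtain ⟨i, hi, x, hx, rfl⟩ := hy
      have h0 : ∀ z, T^[N] x = z → ∑ j ∈ Finset.range (r z), f (T^[j] z) = 0 := by
        intro z hz
        rcases Classical.em (z ∈ tower T N B) with h1 | h1
        · obtain ⟨j, hj, w, hw, rfl⟩ := mem_tower.1 h1
          have hj0 : j = 0 := by
            by_contra hj0
            have h2 : T^[N - 1] x = T^[j - 1] w := by
              apply hinj
              rw [← Function.iterate_succ_apply' T, ← Function.iterate_succ_apply' T]
              convert hz using 2 <;> omega
            have := (h _ (by omega) _ (by omega) x hx w hw h2).1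
            omega
          subst hj0
          rw [hr 0 hj w hw]
          have h3 := hv w hw
          simp only [f, visits, Nat.sub_zero, Function.iterate_zero, id] at h3 ⊢
          rw [Finset.sum_sub_distrib, h3]
          simp
        · rw [hr0 z h1]; simp
      rw [← Function.iterate_succ_apply' T]
      dsimp only
      rw [hr i hi x hx]
      obtain ⟨k, hk⟩ : ∃ k, N - i = k + 1 := ⟨N - i - 1, by omega⟩
      have hgT : ∑ j ∈ Finset.range (r (T^[i + 1] x)), f (T^[j] (T^[i + 1] x)) =
          ∑ j ∈ Finset.range k, f (T^[j + 1] (T^[i] x)) := by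
        rcases Nat.eq_zero_or_pos k with h1 | h1
        · subst h1
          rw [h0 _ (by congr 2; omega)]; simp
        · rw [hr (i + 1) (by omega) x hx, show N - (i + 1) = k by omega]
          refine Finset.sum_congr rfl fun j _ => ?_
          rw [← Function.iterate_add_apply, ← Function.iterate_add_apply]
          congr 2; omega
      rw [hgT, hk, Finset.sum_range_succ']
      simp [f]

end TowerVisits

theorem Finset.exists_card_eq_and_comparable {α : Type*} {s r : Finset α} (hs : s ⊆ r) {m : ℕ}
    (hm : m ≤ r.card) : ∃ u ⊆ r, u.card = m ∧ (s ⊆ u ∨ u ⊆ s) := by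
  rcases le_total s.card m with h | h
  · obtain ⟨u, h1, h2, h3⟩ := Finset.exists_subsuperset_card_eq hs h hm
    exact ⟨u, h2, h3, Or.inl h1⟩
  · obtain ⟨u, h1, h2⟩ := Finset.exists_subset_card_eq h
    exact ⟨u, h1.trans hs, h2, Or.inr h1⟩

theorem visits_eq_card {Ω : Type*} {T : Ω → Ω} {A : Set Ω} {n : ℕ} {x : Ω} {s : Finset ℕ}
    (hs : s ⊆ Finset.range n) (h : ∀ i < n, T^[i] x ∈ A ↔ i ∈ s) :
    visits T A n x = s.card := by
  classical
  have h1 : visits T A n x = ∑ i ∈ Finset.range n, if i ∈ s then (1 : ℝ) else 0 := by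
    refine Finset.sum_congr rfl fun i hi => ?_
    have := h i (Finset.mem_range.1 hi)
    rcases Classical.em (i ∈ s) with h2 | h2
    · simp [h2, this.2 h2]
    · simp [h2, mt this.1 h2]
  rw [h1, Finset.sum_ite_mem, Finset.inter_eq_right.2 hs]
  simp

theorem visits_symmDiff_eq {Ω : Type*} {T : Ω → Ω} {A A' : Set Ω} {n : ℕ} {x : Ω}
    (h : (∀ i < n, T^[i] x ∈ A → T^[i] x ∈ A') ∨ ∀ i < n, T^[i] x ∈ A' → T^[i] x ∈ A) :
    visits T (symmDiff A A') n x = |visits T A n x - visits T A' n x| := by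
  have key : ∀ A A' : Set Ω, (∀ i < n, T^[i] x ∈ A → T^[i] x ∈ A') →
      visits T (symmDiff A A') n x = |visits T A n x - visits T A' n x| := by
    intro A A' h
    have h1 : visits T (symmDiff A A') n x = visits T A' n x - visits T A n x := by
      unfold visits
      rw [← Finset.sum_sub_distrib]
      refine Finset.sum_congr rfl fun i hi => ?_
      have h2 := h i (Finset.mem_range.1 hi)
      rcases Classical.em (T^[i] x ∈ A) with h3 | h3 <;>
        rcases Classical.em (T^[i] x ∈ A') with h4 | h4
      · simp [h3, h4, Set.mem_symmDiff]
      · exact (h4 (h2 h3)).elim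
      · simp [h3, h4, Set.mem_symmDiff]
      · simp [h3, h4, Set.mem_symmDiff]
    rw [abs_sub_comm, ← h1, abs_of_nonneg (visits_nonneg _ _ _ _)]
  rcases h with h | h
  · exact key A A' h
  · rw [symmDiff_comm, abs_sub_comm]
    exact key A' A h

section Refine

variable {Ω : Type*} [MeasurableSpace Ω] [StandardBorelSpace Ω] {μ : Measure Ω}
  [IsProbabilityMeasure μ] {T : Ω → Ω}

/-- An almost coboundary can be turned, by a small modification whose size does not depend on
the new error, into one with an arbitrarily small error. -/
theorem IsAlmostCoboundary.exists_refinement (hT : MeasurePreserving T μ μ)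
    (hTbij : Function.Bijective T) (haper : μ {x | ∃ n ≥ 1, T^[n] x = x} = 0) {q : ℕ}
    (hq : 1 ≤ q) {A : Set Ω} {K η θ : ℝ} (hA : IsAlmostCoboundary μ T (q : ℝ)⁻¹ A K η)
    (hθ : (1 + 2 * K) * η < θ) :
    ∃ K' : ℝ, 0 ≤ K' ∧ ∀ η' > 0, ∃ A' : Set Ω, IsAlmostCoboundary μ T (q : ℝ)⁻¹ A' K' η' ∧
      μ.real (symmDiff A A') ≤ θ := by
  have hinj := hTbij.injective
  have hq0 : (0 : ℝ) < q := by exact_mod_cast hq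
  have hc : (q : ℝ)⁻¹ ∈ Icc (0 : ℝ) 1 :=
    ⟨by positivity, inv_le_one_of_one_le₀ (by exact_mod_cast hq)⟩
  obtain ⟨g, E, hEm, hE, hg, hgE⟩ := hA.exists_transfer
  obtain ⟨x0⟩ : Nonempty Ω := μ.nonempty_of_neZero
  have hK : 0 ≤ K := (abs_nonneg _).trans (hg x0)
  obtain ⟨R, hR⟩ := exists_nat_ge (2 * K / (θ - (1 + 2 * K) * η))
  have hR' : 2 * K ≤ (R + 1) * (θ - (1 + 2 * K) * η) := by
    rw [div_le_iff₀ (by linarith)] at hR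
    nlinarith
  let N := q * (R + 1)
  have hN : 1 ≤ N := Nat.mul_pos hq (by omega)
  have hNR : ((R + 1 : ℕ) : ℝ) ≤ N := by
    exact_mod_cast Nat.le_mul_of_pos_left _ hq
  have hNc : (N : ℝ) * (q : ℝ)⁻¹ = (R + 1 : ℕ) := by
    simp only [N]; push_cast; field_simp
  have hNm : R + 1 ≤ N := by exact_mod_cast hNR
  refine ⟨N, by positivity, fun η' hη' => ?_⟩
  obtain ⟨B, hB, hBt, hBη⟩ := exists_tower hT hTbij haper hN hη'
  classical
  let pat : Ω → Finset ℕ := fun x => (Finset.range N).filter fun i => T^[i] x ∈ A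
  have hΦ : ∀ s : Finset ℕ, ∃ u : Finset ℕ, s ⊆ Finset.range N → u ⊆ Finset.range N ∧
      u.card = R + 1 ∧ (s ⊆ u ∨ u ⊆ s) := by
    intro s
    rcases Classical.em (s ⊆ Finset.range N) with hs | hs
    · obtain ⟨u, hu⟩ := Finset.exists_card_eq_and_comparable hs
        (show R + 1 ≤ (Finset.range N).card by simpa using hNm)
      exact ⟨u, fun _ => hu⟩
    · exact ⟨∅, fun h => (hs h).elim⟩
  choose Φ hΦ using hΦ
  have hpatm : ∀ s : Finset ℕ, MeasurableSet {x | pat x = s} := by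
    intro s
    have : {x | pat x = s} = ⋂ i : ℕ, {x | (i < N ∧ T^[i] x ∈ A) ↔ i ∈ s} := by
      ext x; simp [pat, Finset.ext_iff]
    rw [this]
    refine MeasurableSet.iInter fun i => ?_
    have h1 : MeasurableSet {x | T^[i] x ∈ A} := hT.measurable.iterate i hA.measurableSet
    exact ((MeasurableSet.const _).inter h1).iff (MeasurableSet.const _)
  obtain ⟨A', hA'm, hA'B, hA'E⟩ := hBt.exists_prescribed hT hinj hB hA.measurableSet
    (fun x i => i ∈ Φ (pat x)) (fun i => by
      have : {x | i ∈ Φ (pat x)} = ⋃ s : Finset ℕ, {x | pat x = s} ∩ {_x | i ∈ Φ s} := by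
        ext x; simp
      rw [this]
      exact MeasurableSet.iUnion fun s => (hpatm s).inter (MeasurableSet.const _))
  have hpr : ∀ x, pat x ⊆ Finset.range N := fun x => Finset.filter_subset _ _
  have hvis : ∀ x ∈ B, visits T A' N x = N * (q : ℝ)⁻¹ := by
    intro x hx
    rw [visits_eq_card (hΦ _ (hpr x)).1 (hA'B x hx), (hΦ _ (hpr x)).2.1, hNc]
  refine ⟨A', hBt.isAlmostCoboundary hT hinj hB hBη hA'm hc hvis, ?_⟩
  have hsd : symmDiff A A' = symmDiff A A' ∩ tower T N B := by
    refine (inter_eq_left.2 fun y hy => ?_).symm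
    by_contra h
    have := hA'E y h
    rw [Set.mem_symmDiff] at hy
    tauto
  have hsm : MeasurableSet (symmDiff A A') := hA.measurableSet.symmDiff hA'm
  have hbd : ∀ x ∈ B, visits T (symmDiff A A') N x ≤
      2 * K + (1 + 2 * K) * visits T E N x := by
    intro x hx
    have h1 : ∀ i < N, T^[i] x ∈ A ↔ i ∈ pat x := fun i hi => by simp [pat, hi]
    rw [visits_symmDiff_eq, hvis x hx]
    · exact abs_visits_sub_le_of_transfer hc hg hgE N x
    · rcases (hΦ _ (hpr x)).2.2 with h2 | h2
      · left
        intro i hi h3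
        exact (hA'B x hx i hi).2 (h2 ((h1 i hi).1 h3))
      · right
        intro i hi h3
        exact (h1 i hi).2 (h2 ((hA'B x hx i hi).1 h3))
  rw [hsd, hBt.measure_inter hT hinj hB hsm]
  have hEt : μ.real (E ∩ tower T N B) ≤ η := (measureReal_mono inter_subset_left).trans hE
  rw [hBt.measure_inter hT hinj hB hEm] at hEt
  have hNB := hBt.mul_measure_le_one hT hinj hB
  calc ∫ x in B, visits T (symmDiff A A') N x ∂μ
      ≤ ∫ x in B, (2 * K + (1 + 2 * K) * visits T E N x) ∂μ :=
        setIntegral_mono_on (integrable_visits hT.measurable hsm N)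
          ((integrable_const _).add ((integrable_visits hT.measurable hEm N).const_mul _)) hB hbd
    _ = 2 * K * μ.real B + (1 + 2 * K) * ∫ x in B, visits T E N x ∂μ := by
        rw [integral_add (integrable_const _)
          ((integrable_visits hT.measurable hEm N).const_mul _), integral_const_mul (1 + 2 * K),
          setIntegral_const, smul_eq_mul]
        ring
    _ ≤ (θ - (1 + 2 * K) * η) + (1 + 2 * K) * η := by
        gcongr
        have h0 : (0 : ℝ) ≤ μ.real B := measureReal_nonneg
        push_cast at hNR
        calc 2 * K * μ.real B ≤ ((R + 1) * (θ - (1 + 2 * K) * η)) * μ.real B := by gcongr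
          _ = (θ - (1 + 2 * K) * η) * ((R + 1) * μ.real B) := by ring
          _ ≤ (θ - (1 + 2 * K) * η) * (N * μ.real B) := by
            have : 0 ≤ θ - (1 + 2 * K) * η := by linarith
            gcongr
          _ ≤ (θ - (1 + 2 * K) * η) * 1 := by
            have : 0 ≤ θ - (1 + 2 * K) * η := by linarith
            gcongr
          _ = _ := by ring
    _ = θ := by ring

end Refine

theorem exists_limit_set {Ω : Type*} [MeasurableSpace Ω] {μ : Measure Ω} [IsProbabilityMeasure μ]
    {A : ℕ → Set Ω} (hA : ∀ k, MeasurableSet (A k)) {θ : ℕ → ℝ} (hθ0 : ∀ k, 0 ≤ θ k)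
    (hθ : ∀ k, θ (k + 1) ≤ θ k / 2) (h : ∀ k, μ.real (symmDiff (A k) (A (k + 1))) ≤ θ k) :
    ∃ L : Set Ω, MeasurableSet L ∧ ∀ k, μ.real (symmDiff (A k) L) ≤ 2 * θ k := by
  refine ⟨⋃ k, ⋂ j, A (k + j), MeasurableSet.iUnion fun k => MeasurableSet.iInter fun j => hA _,
    fun k => ?_⟩
  have hpow : ∀ j, θ (k + j) ≤ θ k * (1 / 2) ^ j := by
    intro j
    induction j with
    | zero => simp
    | succ j ih =>
      calc θ (k + (j + 1)) ≤ θ (k + j) / 2 := hθ (k + j)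
        _ ≤ θ k * (1 / 2) ^ j / 2 := by gcongr
        _ = _ := by ring
  have hsub : symmDiff (A k) (⋃ k, ⋂ j, A (k + j)) ⊆
      ⋃ j, symmDiff (A (k + j)) (A (k + j + 1)) := by
    intro x hx
    by_contra hcon
    have hstep : ∀ j, x ∈ A (k + j) ↔ x ∈ A (k + j + 1) := by
      intro j
      have : x ∉ symmDiff (A (k + j)) (A (k + j + 1)) := fun h => hcon (mem_iUnion.2 ⟨j, h⟩)
      rw [Set.mem_symmDiff] at this
      tauto
    have hall : ∀ j, x ∈ A k ↔ x ∈ A (k + j) := by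
      intro j
      induction j with
      | zero => rfl
      | succ j ih => exact ih.trans (hstep j)
    rw [Set.mem_symmDiff] at hx
    simp only [mem_iUnion, mem_iInter] at hx
    rcases hx with ⟨h1, h2⟩ | ⟨⟨l, h1⟩, h2⟩
    · exact h2 ⟨k, fun j => (hall j).1 h1⟩
    · have h3 := h1 k
      rw [add_comm] at h3
      exact h2 ((hall l).2 h3)
  have hsum : HasSum (fun j : ℕ => θ k * (1 / 2 : ℝ) ^ j) (2 * θ k) := by
    have := hasSum_geometric_two.mul_left (θ k)
    rwa [mul_comm (θ k) 2] at this
  have hle : μ (⋃ j, symmDiff (A (k + j)) (A (k + j + 1))) ≤ ENNReal.ofReal (2 * θ k) :=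
    calc μ (⋃ j, symmDiff (A (k + j)) (A (k + j + 1)))
        ≤ ∑' j, μ (symmDiff (A (k + j)) (A (k + j + 1))) := measure_iUnion_le _
      _ ≤ ∑' j, ENNReal.ofReal (θ k * (1 / 2 : ℝ) ^ j) := by
          refine ENNReal.tsum_le_tsum fun j => ?_
          rw [← ofReal_measureReal]
          exact ENNReal.ofReal_le_ofReal ((h _).trans (hpow j))
      _ = ENNReal.ofReal (2 * θ k) := by
          rw [← ENNReal.ofReal_tsum_of_nonneg
            (fun j => mul_nonneg (hθ0 k) (by positivity)) hsum.summable, hsum.tsum_eq]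
  rw [measureReal_def]
  exact ENNReal.toReal_le_of_le_ofReal (by linarith [hθ0 k]) ((measure_mono hsub).trans hle)

theorem measureReal_exists_iterate_mem_le {Ω : Type*} [MeasurableSpace Ω] {μ : Measure Ω}
    [IsProbabilityMeasure μ] {T : Ω → Ω} (hT : MeasurePreserving T μ μ) {S : Set Ω}
    (hS : MeasurableSet S) (n : ℕ) :
    μ.real {x | ∃ i < n, T^[i] x ∈ S} ≤ n * μ.real S := by
  have h1 : {x | ∃ i < n, T^[i] x ∈ S} = ⋃ i ∈ Finset.range n, T^[i] ⁻¹' S := by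
    ext x; simp
  rw [h1]
  refine (measureReal_biUnion_finset_le _ _).trans ?_
  simp_rw [fun i => (hT.iterate i).measureReal_preimage hS.nullMeasurableSet]
  simp

theorem abs_measureReal_sub_le_symmDiff {Ω : Type*} [MeasurableSpace Ω] {μ : Measure Ω}
    [IsProbabilityMeasure μ] (A A' : Set Ω) :
    |μ.real A - μ.real A'| ≤ μ.real (symmDiff A A') := by
  have key : ∀ A A' : Set Ω, μ.real A ≤ μ.real A' + μ.real (symmDiff A A') := by
    intro A A'
    refine (measureReal_mono fun x hx => ?_).trans (measureReal_union_le A' (symmDiff A A'))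
    rcases Classical.em (x ∈ A') with h | h
    · exact Or.inl h
    · exact Or.inr (Or.inl ⟨hx, h⟩)
  have h1 := key A A'
  have h2 := key A' A
  rw [symmDiff_comm] at h2
  rw [abs_le]
  constructor <;> linarith

theorem visits_congr {Ω : Type*} {T : Ω → Ω} {A A' : Set Ω} {n : ℕ} {x : Ω}
    (h : ∀ i < n, T^[i] x ∉ symmDiff A A') : visits T A n x = visits T A' n x := by
  refine Finset.sum_congr rfl fun i hi => ?_
  have := h i (Finset.mem_range.1 hi)
  rw [Set.mem_symmDiff] at this
  rcases Classical.em (T^[i] x ∈ A) with h1 | h1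
  · have h2 : T^[i] x ∈ A' := by tauto
    simp [h1, h2]
  · have h2 : T^[i] x ∉ A' := by tauto
    simp [h1, h2]

section Limit

variable {Ω : Type*} [MeasurableSpace Ω] [StandardBorelSpace Ω] {μ : Measure Ω}
  [IsProbabilityMeasure μ] {T : Ω → Ω}

/-- Near an almost coboundary there is a set whose centred visit counts are negligible with
respect to `a` along arbitrarily large times. -/
theorem IsAlmostCoboundary.exists_limit (hT : MeasurePreserving T μ μ)
    (hTbij : Function.Bijective T) (haper : μ {x | ∃ n ≥ 1, T^[n] x = x} = 0)
    {a : ℕ → ℝ} (ha : Tendsto a atTop atTop) {q : ℕ}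
    (hq : 1 ≤ q) {A₀ : Set Ω} {K η θ : ℝ} (hA₀ : IsAlmostCoboundary μ T (q : ℝ)⁻¹ A₀ K η)
    (hθ : (1 + 2 * K) * η < θ) :
    ∃ A : Set Ω, MeasurableSet A ∧ μ.real (symmDiff A₀ A) ≤ 2 * θ ∧ μ.real A = (q : ℝ)⁻¹ ∧
      ∀ δ > 0, ∀ M : ℕ, ∃ n ≥ M,
        μ.real {x | δ * a n < |visits T A n x - n * (q : ℝ)⁻¹|} ≤ δ := by
  obtain ⟨x0⟩ : Nonempty Ω := μ.nonempty_of_neZero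
  have hc : (q : ℝ)⁻¹ ∈ Icc (0 : ℝ) 1 :=
    ⟨by positivity, inv_le_one_of_one_le₀ (by exact_mod_cast hq)⟩
  have hK0 : ∀ {A K η}, IsAlmostCoboundary μ T (q : ℝ)⁻¹ A K η → 0 ≤ K := by
    rintro A K η h
    obtain ⟨g, -, -, -, hg, -⟩ := h.exists_transfer
    exact (abs_nonneg _).trans (hg x0)
  have hη0 : ∀ {A K η}, IsAlmostCoboundary μ T (q : ℝ)⁻¹ A K η → 0 ≤ η := fun h =>
    (abs_nonneg _).trans h.measure_close
  let good : Set Ω × ℝ × ℝ × ℝ → Prop := fun s =>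
    IsAlmostCoboundary μ T (q : ℝ)⁻¹ s.1 s.2.1 s.2.2.1 ∧ (1 + 2 * s.2.1) * s.2.2.1 < s.2.2.2
  have hgood : ∀ s, good s → 0 < s.2.2.2 ∧ s.2.2.1 < s.2.2.2 := by
    rintro ⟨A, K, η, θ⟩ ⟨h1, h2⟩
    have h3 := hK0 h1
    have h4 := hη0 h1
    dsimp only at *
    constructor <;> nlinarith
  have hstep : ∀ (k : ℕ) (s : {s // good s}), ∃ s' : {s // good s},
      s'.1.2.2.2 ≤ s.1.2.2.2 / 2 ∧ μ.real (symmDiff s.1.1 s'.1.1) ≤ s.1.2.2.2 ∧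
      ∃ n ≥ k, 2 * s'.1.2.1 ≤ 1 / ((k : ℝ) + 1) * a n ∧
        n * (s'.1.2.2.1 + 2 * s'.1.2.2.2) ≤ 1 / ((k : ℝ) + 1) := by
    rintro k ⟨⟨A, K, η, θ⟩, hs⟩
    have hs' := hgood _ hs
    obtain ⟨h1, h2⟩ := hs
    obtain ⟨hθ0, -⟩ := hs'
    dsimp only at h1 h2 hθ0 ⊢
    obtain ⟨K', hK', href⟩ := h1.exists_refinement hT hTbij haper hq h2
    obtain ⟨n, hn1, hn2⟩ :=
      ((ha.eventually_ge_atTop (2 * K' * (k + 1))).and (eventually_ge_atTop (max k 1))).exists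
    have hn0 : (0 : ℝ) < n := by
      exact_mod_cast (le_max_right k 1).trans hn2
    have hk0 : (0 : ℝ) < (k : ℝ) + 1 := by positivity
    obtain ⟨θ', hθ'0, hθ'1, hθ'2⟩ : ∃ θ' > 0, θ' ≤ θ / 2 ∧ θ' ≤ 1 / (3 * n * (k + 1)) :=
      ⟨min (θ / 2) (1 / (3 * n * (k + 1))), lt_min (by positivity) (by positivity),
        min_le_left _ _, min_le_right _ _⟩
    have hη' : (1 + 2 * K') * (θ' / (2 * (1 + 2 * K'))) < θ' := by
      have : 0 < 1 + 2 * K' := by positivity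
      field_simp
      norm_num
    obtain ⟨A', hA', hAA'⟩ := href (θ' / (2 * (1 + 2 * K'))) (by positivity)
    have hg' : good (A', K', θ' / (2 * (1 + 2 * K')), θ') := ⟨hA', hη'⟩
    refine ⟨⟨_, hg'⟩, hθ'1, hAA', n, (le_max_left k 1).trans hn2, ?_, ?_⟩
    · dsimp only
      rw [one_div_mul_eq_div, le_div_iff₀ hk0]
      exact hn1
    · have h5 := (hgood _ hg').2
      dsimp only at h5 ⊢
      calc (n : ℝ) * (θ' / (2 * (1 + 2 * K')) + 2 * θ') ≤ n * (θ' + 2 * θ') := by gcongr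
        _ = 3 * n * θ' := by ring
        _ ≤ 3 * n * (1 / (3 * n * (k + 1))) := by gcongr
        _ = 1 / ((k : ℝ) + 1) := by field_simp
  choose next hnext using hstep
  let S : ℕ → {s // good s} := fun k => Nat.rec ⟨(A₀, K, η, θ), hA₀, hθ⟩ next k
  have hS : ∀ k, S (k + 1) = next k (S k) := fun k => rfl
  have hR := fun k => hnext k (S k)
  simp only [← hS] at hR
  obtain ⟨L, hLm, hL⟩ := exists_limit_set (A := fun k => (S k).1.1)
    (θ := fun k => (S k).1.2.2.2) (fun k => (S k).2.1.measurableSet)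
    (fun k => (hgood _ (S k).2).1.le) (fun k => (hR k).1) (fun k => (hR k).2.1)
  refine ⟨L, hLm, hL 0, ?_, ?_⟩
  · have hpow : ∀ k, (S k).1.2.2.2 ≤ θ * (1 / 2) ^ k := by
      intro k
      induction k with
      | zero => simp [S]
      | succ k ih =>
        calc (S (k + 1)).1.2.2.2 ≤ (S k).1.2.2.2 / 2 := (hR k).1
          _ ≤ θ * (1 / 2) ^ k / 2 := by gcongr
          _ = _ := by ring
    have hclose : ∀ k, |μ.real L - (q : ℝ)⁻¹| ≤ 3 * (θ * (1 / 2) ^ k) := by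
      intro k
      have h1 := (abs_measureReal_sub_le_symmDiff (μ := μ) (S k).1.1 L).trans (hL k)
      have h2 := (S k).2.1.measure_close
      have h3 := (hgood _ (S k).2).2
      have h4 := hpow k
      rw [abs_le] at h1 h2 ⊢
      constructor <;> linarith [h1.1, h1.2, h2.1, h2.2]
    have hlim : Tendsto (fun k : ℕ => 3 * (θ * (1 / 2 : ℝ) ^ k)) atTop (𝓝 (3 * (θ * 0))) :=
      ((tendsto_pow_atTop_nhds_zero_of_lt_one (by norm_num) (by norm_num)).const_mul θ).const_mul 3
    have := ge_of_tendsto' hlim hclose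
    simp only [mul_zero] at this
    linarith [abs_nonpos_iff.1 this]
  · intro δ hδ M
    obtain ⟨k0, hk0⟩ := exists_nat_one_div_lt hδ
    let k := max k0 M
    have hkδ : 1 / ((k : ℝ) + 1) ≤ δ := by
      refine le_trans ?_ hk0.le
      have : (k0 : ℝ) ≤ k := by exact_mod_cast le_max_left k0 M
      gcongr
    obtain ⟨-, -, n, hnk, hn1, hn2⟩ := hR k
    refine ⟨n, (le_max_right k0 M).trans hnk, ?_⟩
    obtain ⟨g, E, hEm, hE, hg, hgE⟩ := (S (k + 1)).2.1.exists_transfer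
    have hSm := (S (k + 1)).2.1.measurableSet
    have hDm : MeasurableSet (symmDiff (S (k + 1)).1.1 L) := hSm.symmDiff hLm
    have han : 0 ≤ a n := by
      have h1 : 0 ≤ 1 / ((k : ℝ) + 1) * a n := by linarith [hK0 (S (k + 1)).2.1]
      exact nonneg_of_mul_nonneg_right h1 (by positivity)
    have hsub : {x | δ * a n < |visits T L n x - n * (q : ℝ)⁻¹|} ⊆
        {x | ∃ i < n, T^[i] x ∈ E ∪ symmDiff (S (k + 1)).1.1 L} := by
      intro x hx
      by_contra hcon
      simp only [mem_ofPred_eq, mem_union, not_exists, not_and, not_or] at hcon hx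
      have h1 := visits_congr (T := T) (x := x) fun i hi => (hcon i hi).2
      have h2 : visits T E n x = 0 := Finset.sum_eq_zero fun i hi =>
        indicator_of_notMem (hcon i (Finset.mem_range.1 hi)).1 _
      have h3 := abs_visits_sub_le_of_transfer hc hg hgE n x
      rw [h1, h2] at h3
      have h4 : 1 / ((k : ℝ) + 1) * a n ≤ δ * a n := by gcongr
      linarith
    calc μ.real {x | δ * a n < |visits T L n x - n * (q : ℝ)⁻¹|}
        ≤ n * μ.real (E ∪ symmDiff (S (k + 1)).1.1 L) :=
          (measureReal_mono hsub).trans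
            (measureReal_exists_iterate_mem_le hT (hEm.union hDm) n)
      _ ≤ n * (μ.real E + μ.real (symmDiff (S (k + 1)).1.1 L)) := by
          gcongr; exact measureReal_union_le _ _
      _ ≤ n * ((S (k + 1)).1.2.2.1 + 2 * (S (k + 1)).1.2.2.2) := by
          gcongr; exact hL (k + 1)
      _ ≤ δ := hn2.trans hkδ

end Limit

theorem levyDist_le {μ ν : Measure ℝ} {ε : ℝ} (hε : 0 < ε)
    (h1 : ∀ t, ProbabilityTheory.cdf ν (t - ε) - ε ≤ ProbabilityTheory.cdf μ t)
    (h2 : ∀ t, ProbabilityTheory.cdf μ t ≤ ProbabilityTheory.cdf ν (t + ε) + ε) :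
    levyDist μ ν ≤ ε :=
  csInf_le ⟨0, fun _ h => h.1.le⟩ ⟨hε, fun t => ⟨h1 t, h2 t⟩⟩

theorem cdf_map_eq {Ω : Type*} [MeasurableSpace Ω] {μ : Measure Ω} [IsProbabilityMeasure μ]
    {Y : Ω → ℝ} (hY : Measurable Y) (t : ℝ) :
    ProbabilityTheory.cdf (μ.map Y) t = μ.real {x | Y x ≤ t} := by
  have := Measure.isProbabilityMeasure_map (μ := μ) hY.aemeasurable
  rw [ProbabilityTheory.cdf_eq_real, map_measureReal_apply hY measurableSet_Iic]
  rfl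

theorem levyDist_map_dirac_le {Ω : Type*} [MeasurableSpace Ω] {μ : Measure Ω}
    [IsProbabilityMeasure μ] {Y : Ω → ℝ} (hY : Measurable Y) {δ : ℝ} (hδ : 0 < δ)
    (h : μ.real {x | δ < |Y x|} ≤ δ) :
    levyDist (μ.map Y) (Measure.dirac 0) ≤ δ := by
  have hd : ∀ t : ℝ, ProbabilityTheory.cdf (Measure.dirac (0 : ℝ)) t = if 0 ≤ t then 1 else 0 := by
    intro t
    rw [ProbabilityTheory.cdf_eq_real, measureReal_def, Measure.dirac_apply' _ measurableSet_Iic]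
    simp only [indicator, mem_Iic]
    split_ifs <;> simp
  refine levyDist_le hδ (fun t => ?_) fun t => ?_
  · rw [hd, cdf_map_eq hY]
    split_ifs with ht
    · have h1 : μ.real {x | δ < |Y x|}ᶜ ≤ μ.real {x | Y x ≤ t} := by
        refine measureReal_mono fun x hx => ?_
        simp only [mem_compl_iff, mem_ofPred_eq, not_lt] at hx ⊢
        linarith [le_abs_self (Y x)]
      rw [probReal_compl_eq_one_sub (measurableSet_lt measurable_const hY.abs)] at h1
      linarith
    · have : 0 ≤ μ.real {x | Y x ≤ t} := measureReal_nonneg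
      linarith
  · rw [hd, cdf_map_eq hY]
    split_ifs with ht
    · have : μ.real {x | Y x ≤ t} ≤ 1 := measureReal_le_one
      linarith
    · have h1 : μ.real {x | Y x ≤ t} ≤ μ.real {x | δ < |Y x|} := by
        refine measureReal_mono fun x hx => ?_
        simp only [mem_ofPred_eq, not_le] at hx ht ⊢
        linarith [neg_abs_le (Y x)]
      linarith

/-- If `Y` is close to `v j` on most of the `j`-th of `M` disjoint cells of equal mass, which
nearly exhaust the space, then its law is close to any law close to the uniform one on the
`v j`. -/
theorem levyDist_map_le_of_cells {Ω : Type*} [MeasurableSpace Ω] {μ : Measure Ω}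
    [IsProbabilityMeasure μ] {Y : Ω → ℝ} (hY : Measurable Y) {ν : Measure ℝ} {M : ℕ}
    (hM : 1 ≤ M) {v : ℕ → ℝ} {s b b' w ε : ℝ} (hε : 0 < ε) (hs : 0 ≤ s)
    (hνu : ∀ t, (((Finset.range M).filter fun j => v j ≤ t).card : ℝ) / M ≤
      ProbabilityTheory.cdf ν (t + s) + s)
    (hνl : ∀ t, ProbabilityTheory.cdf ν t ≤
      (((Finset.range M).filter fun j => v j ≤ t).card : ℝ) / M + s)
    {C : ℕ → Set Ω} (hC : ∀ j, MeasurableSet (C j))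
    (hCd : (Finset.range M : Set ℕ).PairwiseDisjoint C)
    (hCw : ∀ j < M, μ.real (C j) = w) (hw : 1 - M * w ≤ b) {Z : Set Ω} (hZ : μ.real Z ≤ b')
    (hYv : ∀ j < M, ∀ x ∈ C j, x ∉ Z → |Y x - v j| ≤ s) (hsum : 2 * s + b + b' ≤ ε) :
    levyDist (μ.map Y) ν ≤ ε := by
  have hM0 : (0 : ℝ) < M := by exact_mod_cast hM
  have hunion : ∀ F ⊆ Finset.range M, μ.real (⋃ j ∈ F, C j) = F.card * w := by
    intro F hF
    rw [measureReal_biUnion_finset (hCd.subset (by exact_mod_cast hF)) fun j _ => hC j,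
      Finset.sum_congr rfl fun j hj => hCw j (Finset.mem_range.1 (hF hj))]
    simp
  have hMw : M * w ≤ 1 := by
    have := hunion _ subset_rfl
    rw [Finset.card_range] at this
    rw [← this]; exact measureReal_le_one
  have hw1 : w ≤ 1 / M := by rw [le_div_iff₀ hM0]; linarith
  refine levyDist_le hε (fun t => ?_) fun t => ?_
  · rw [cdf_map_eq hY]
    set F := (Finset.range M).filter fun j => v j ≤ t - s with hF
    have h1 : μ.real (⋃ j ∈ F, C j) ≤ μ.real {x | Y x ≤ t} + b' := by
      refine (measureReal_mono fun x hx => ?_).trans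
        ((measureReal_union_le {x | Y x ≤ t} Z).trans (by gcongr))
      simp only [mem_iUnion] at hx
      obtain ⟨j, hj, hx⟩ := hx
      rw [hF, Finset.mem_filter, Finset.mem_range] at hj
      rcases Classical.em (x ∈ Z) with h | h
      · exact Or.inr h
      · left
        have := abs_le.1 (hYv j hj.1 x hx h)
        simp only [mem_ofPred_eq]
        linarith [this.2, hj.2]
    rw [hunion F (Finset.filter_subset _ _)] at h1
    have h2 : (F.card : ℝ) / M - b ≤ F.card * w := by
      have h3 : (F.card : ℝ) ≤ M := by
        have := Finset.card_le_card (Finset.filter_subset (fun j => v j ≤ t - s) (Finset.range M))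
        rw [Finset.card_range] at this
        exact_mod_cast this
      have h4 : (F.card : ℝ) * (1 / M - w) ≤ M * (1 / M - w) :=
        mul_le_mul_of_nonneg_right h3 (by linarith)
      have h5 : (M : ℝ) * (1 / M - w) = 1 - M * w := by field_simp
      have h6 : (F.card : ℝ) * (1 / M - w) = F.card / M - F.card * w := by ring
      linarith
    have h3 := hνl (t - s)
    have h4 : ProbabilityTheory.cdf ν (t - ε) ≤ ProbabilityTheory.cdf ν (t - s) := by
      apply ProbabilityTheory.monotone_cdf
      have : 0 ≤ b' := measureReal_nonneg.trans hZ
      linarith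
    have : 0 ≤ b' := measureReal_nonneg.trans hZ
    linarith
  · rw [cdf_map_eq hY]
    set F := (Finset.range M).filter fun j => v j ≤ t + s with hF
    have hb' : 0 ≤ b' := measureReal_nonneg.trans hZ
    have h1 : μ.real {x | Y x ≤ t} ≤
        μ.real (⋃ j ∈ F, C j) + (μ.real Z + μ.real (⋃ j ∈ Finset.range M, C j)ᶜ) := by
      refine (measureReal_mono (fun x hx => ?_)).trans ((measureReal_union_le (⋃ j ∈ F, C j)
        (Z ∪ (⋃ j ∈ Finset.range M, C j)ᶜ)).trans (by gcongr; exact measureReal_union_le _ _))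
      rcases Classical.em (x ∈ Z) with h | h
      · exact Or.inr (Or.inl h)
      rcases Classical.em (x ∈ ⋃ j ∈ Finset.range M, C j) with h' | h'
      · left
        simp only [mem_iUnion, Finset.mem_range] at h'
        obtain ⟨j, hj, hxj⟩ := h'
        refine mem_biUnion (x := j) ?_ hxj
        have h2 := abs_le.1 (hYv j hj x hxj h)
        simp only [mem_ofPred_eq] at hx
        simp only [hF, Finset.coe_filter, Finset.mem_range, mem_ofPred_eq]
        exact ⟨hj, by linarith [h2.1]⟩
      · exact Or.inr (Or.inr h')
    rw [hunion F (Finset.filter_subset _ _), probReal_compl_eq_one_sub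
      (Finset.measurableSet_biUnion _ fun j _ => hC j), hunion _ subset_rfl,
      Finset.card_range] at h1
    have h2 : (F.card : ℝ) * w ≤ F.card / M := by
      rw [div_eq_mul_one_div]; gcongr
    have h3 := hνu (t + s)
    have h4 : ProbabilityTheory.cdf ν (t + s + s) ≤ ProbabilityTheory.cdf ν (t + ε) := by
      apply ProbabilityTheory.monotone_cdf
      linarith
    linarith

/-- The quantile function of a measure on the line. -/
noncomputable def quantile (ν : Measure ℝ) (u : ℝ) : ℝ :=
  sInf {t | u ≤ ProbabilityTheory.cdf ν t}

section Quantile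

variable {ν : Measure ℝ}

theorem quantile_le_iff {u t : ℝ} (hu : u ∈ Ioo (0 : ℝ) 1) :
    quantile ν u ≤ t ↔ u ≤ ProbabilityTheory.cdf ν t := by
  have hbdd : BddBelow {t | u ≤ ProbabilityTheory.cdf ν t} := by
    obtain ⟨r, hr⟩ := ((ProbabilityTheory.tendsto_cdf_atBot ν).eventually_lt_const hu.1).exists
    refine ⟨r, fun t ht => ?_⟩
    by_contra h
    exact absurd (ht.trans (ProbabilityTheory.monotone_cdf ν (not_le.1 h).le)) (not_le.2 hr)
  have hne : {t | u ≤ ProbabilityTheory.cdf ν t}.Nonempty := by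
    obtain ⟨r, hr⟩ := ((ProbabilityTheory.tendsto_cdf_atTop ν).eventually_const_lt hu.2).exists
    exact ⟨r, hr.le⟩
  refine ⟨fun h => ?_, fun h => csInf_le hbdd h⟩
  have h1 : ∀ r > t, u ≤ ProbabilityTheory.cdf ν r := by
    intro r hr
    obtain ⟨y, hy, hyr⟩ := exists_lt_of_csInf_lt hne (h.trans_lt hr)
    exact le_trans hy (ProbabilityTheory.monotone_cdf ν hyr.le)
  have h2 : Tendsto (ProbabilityTheory.cdf ν) (𝓝[>] t) (𝓝 (ProbabilityTheory.cdf ν t)) :=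
    ((ProbabilityTheory.cdf ν).right_continuous t).tendsto.mono_left
      (nhdsWithin_mono _ Ioi_subset_Ici_self)
  exact ge_of_tendsto h2 (by filter_upwards [self_mem_nhdsWithin] with r hr using h1 r hr)

theorem monotoneOn_quantile : MonotoneOn (quantile ν) (Ioo 0 1) := by
  intro x hx y hy hxy
  rw [quantile_le_iff hx]
  exact hxy.trans ((quantile_le_iff hy).1 le_rfl)

theorem map_quantile [IsProbabilityMeasure ν] :
    (volume.restrict (Ioo (0 : ℝ) 1)).map (quantile ν) = ν := by
  have hm : AEMeasurable (quantile ν) (volume.restrict (Ioo (0 : ℝ) 1)) :=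
    aemeasurable_restrict_of_monotoneOn measurableSet_Ioo monotoneOn_quantile
  have : IsProbabilityMeasure (volume.restrict (Ioo (0 : ℝ) 1)) := ⟨by simp⟩
  have := Measure.isProbabilityMeasure_map hm
  refine Measure.ext_of_Iic _ _ fun t => ?_
  rw [Measure.map_apply_of_aemeasurable hm measurableSet_Iic, ← ProbabilityTheory.ofReal_cdf,
    Measure.restrict_apply' measurableSet_Ioo]
  have h0 := ProbabilityTheory.cdf_nonneg ν t
  have h1 := ProbabilityTheory.cdf_le_one ν t
  have h2 : quantile ν ⁻¹' Iic t ∩ Ioo 0 1 = Ioo 0 1 ∩ Iic (ProbabilityTheory.cdf ν t) := by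
    ext u
    simp only [mem_inter_iff, mem_preimage, mem_Iic]
    constructor
    · rintro ⟨h, hu⟩; exact ⟨hu, (quantile_le_iff hu).1 h⟩
    · rintro ⟨hu, h⟩; exact ⟨(quantile_le_iff hu).2 h, hu⟩
  rw [h2]
  apply le_antisymm
  · calc volume (Ioo 0 1 ∩ Iic (ProbabilityTheory.cdf ν t))
        ≤ volume (Ioc 0 (ProbabilityTheory.cdf ν t)) := measure_mono fun u hu => ⟨hu.1.1, hu.2⟩
      _ = _ := by simp
  · calc ENNReal.ofReal (ProbabilityTheory.cdf ν t)
        = volume (Ioo 0 (ProbabilityTheory.cdf ν t)) := by simp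
      _ ≤ volume (Ioo 0 1 ∩ Iic (ProbabilityTheory.cdf ν t)) :=
        measure_mono fun u hu => ⟨⟨hu.1, hu.2.trans_le h1⟩, hu.2.le⟩

theorem intervalIntegrable_quantile [IsProbabilityMeasure ν]
    (hν : Integrable (fun x : ℝ => x) ν) : IntervalIntegrable (quantile ν) volume 0 1 := by
  have hm : AEMeasurable (quantile ν) (volume.restrict (Ioo (0 : ℝ) 1)) :=
    aemeasurable_restrict_of_monotoneOn measurableSet_Ioo monotoneOn_quantile
  rw [intervalIntegrable_iff_integrableOn_Ioo_of_le zero_le_one]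
  rw [← map_quantile (ν := ν)] at hν
  exact (integrable_map_measure aestronglyMeasurable_id hm).1 hν

theorem intervalIntegral_quantile [IsProbabilityMeasure ν] :
    ∫ u in (0 : ℝ)..1, quantile ν u = ∫ x, x ∂ν := by
  have hm : AEMeasurable (quantile ν) (volume.restrict (Ioo (0 : ℝ) 1)) :=
    aemeasurable_restrict_of_monotoneOn measurableSet_Ioo monotoneOn_quantile
  rw [intervalIntegral.integral_of_le zero_le_one, integral_Ioc_eq_integral_Ioo]
  conv_rhs => rw [← map_quantile (ν := ν)]
  exact (integral_map hm aestronglyMeasurable_id).symm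

/-- A centred law is close to the uniform law on finitely many points with zero sum. -/
theorem exists_uniform_approx [IsProbabilityMeasure ν] (hν : Integrable (fun x : ℝ => x) ν)
    (hν0 : ∫ x, x ∂ν = 0) {s : ℝ} (hs : 0 < s) :
    ∃ M : ℕ, 1 ≤ M ∧ ∃ v : ℕ → ℝ, ∑ j ∈ Finset.range M, v j = 0 ∧
      (∀ t, (((Finset.range M).filter fun j => v j ≤ t).card : ℝ) / M ≤
        ProbabilityTheory.cdf ν (t + s) + s) ∧
      ∀ t, ProbabilityTheory.cdf ν t ≤
        (((Finset.range M).filter fun j => v j ≤ t).card : ℝ) / M + s := by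
  obtain ⟨m, hm⟩ := exists_nat_one_div_lt hs
  let M := m + 1
  have hM0 : (0 : ℝ) < M := by positivity
  have hMs : 1 / (M : ℝ) ≤ s := by simp only [M]; push_cast; exact hm.le
  let c : ℕ → ℝ := fun j => j / M
  have hc : ∀ j, c (j + 1) - c j = 1 / M := fun j => by simp only [c]; push_cast; ring
  have hcM : ∀ j ≤ M, c j ≤ 1 := fun j hj => by
    rw [div_le_one hM0]; exact_mod_cast hj
  have hc0 : ∀ j, 0 ≤ c j := fun j => by positivity
  have hcle : ∀ j, c j ≤ c (j + 1) := fun j => by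
    have := hc j
    have : 0 < 1 / (M : ℝ) := by positivity
    linarith
  have hII : ∀ j < M, IntervalIntegrable (quantile ν) volume (c j) (c (j + 1)) := by
    intro j hj
    refine (intervalIntegrable_quantile hν).mono_set ?_
    rw [uIcc_of_le (hcle j), uIcc_of_le zero_le_one]
    exact Icc_subset_Icc (hc0 j) (hcM _ hj)
  have hIoo : ∀ j < M, ∀ u ∈ Ioo (c j) (c (j + 1)), u ∈ Ioo (0 : ℝ) 1 := fun j hj u hu =>
    ⟨(hc0 j).trans_lt hu.1, hu.2.trans_le (hcM _ hj)⟩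
  let v : ℕ → ℝ := fun j => M * ∫ u in c j..c (j + 1), quantile ν u
  have hup : ∀ j < M, ∀ t, c (j + 1) ≤ ProbabilityTheory.cdf ν t → v j ≤ t := by
    intro j hj t ht
    have h1 : ∫ u in c j..c (j + 1), quantile ν u ≤ ∫ _u in c j..c (j + 1), t :=
      intervalIntegral.integral_mono_on_of_le_Ioo (hcle j) (hII j hj) intervalIntegrable_const
        fun u hu => (quantile_le_iff (hIoo j hj u hu)).2 (hu.2.le.trans ht)
    rw [intervalIntegral.integral_const, hc, smul_eq_mul] at h1
    calc v j ≤ M * (1 / M * t) := by simp only [v]; gcongr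
      _ = t := by field_simp
  have hlow : ∀ j < M, ∀ t, ProbabilityTheory.cdf ν t < c j → t ≤ v j := by
    intro j hj t ht
    have h1 : ∫ _u in c j..c (j + 1), t ≤ ∫ u in c j..c (j + 1), quantile ν u :=
      intervalIntegral.integral_mono_on_of_le_Ioo (hcle j) intervalIntegrable_const (hII j hj)
        fun u hu => by
          by_contra h
          exact absurd ((quantile_le_iff (hIoo j hj u hu)).1 (not_le.1 h).le)
            (not_le.2 (ht.trans hu.1))
    rw [intervalIntegral.integral_const, hc, smul_eq_mul] at h1
    calc t = M * (1 / M * t) := by field_simp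
      _ ≤ v j := by simp only [v]; gcongr
  refine ⟨M, by omega, v, ?_, fun t => ?_, fun t => ?_⟩
  · simp only [v]
    rw [← Finset.mul_sum, intervalIntegral.sum_integral_adjacent_intervals hII]
    have h1 : c M = 1 := div_self hM0.ne'
    have h2 : c 0 = 0 := by simp [c]
    rw [h1, h2, intervalIntegral_quantile, hν0, mul_zero]
  · have hF0 := ProbabilityTheory.cdf_nonneg ν (t + s)
    have hsub : ((Finset.range M).filter fun j => v j ≤ t) ⊆
        Finset.range (⌊M * ProbabilityTheory.cdf ν (t + s)⌋₊ + 1) := by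
      intro j hj
      rw [Finset.mem_filter, Finset.mem_range] at hj
      rw [Finset.mem_range, Nat.lt_succ_iff]
      apply Nat.le_floor
      by_contra h
      have : t + s ≤ v j := hlow j hj.1 _ (by rw [lt_div_iff₀ hM0]; linarith)
      linarith [hj.2]
    have h1 := Finset.card_le_card hsub
    rw [Finset.card_range] at h1
    have h2 : (((Finset.range M).filter fun j => v j ≤ t).card : ℝ) ≤
        M * ProbabilityTheory.cdf ν (t + s) + 1 := by
      have h3 := Nat.floor_le (mul_nonneg hM0.le hF0)
      have h4 : (((Finset.range M).filter fun j => v j ≤ t).card : ℝ) ≤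
        (⌊M * ProbabilityTheory.cdf ν (t + s)⌋₊ : ℝ) + 1 := by exact_mod_cast h1
      linarith
    calc _ ≤ (M * ProbabilityTheory.cdf ν (t + s) + 1) / M := by gcongr
      _ = ProbabilityTheory.cdf ν (t + s) + 1 / M := by field_simp
      _ ≤ _ := by gcongr
  · have hF0 := ProbabilityTheory.cdf_nonneg ν t
    have hF1 := ProbabilityTheory.cdf_le_one ν t
    have hfl := Nat.floor_le (mul_nonneg hM0.le hF0)
    have hsub : Finset.range ⌊M * ProbabilityTheory.cdf ν t⌋₊ ⊆
        (Finset.range M).filter fun j => v j ≤ t := by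
      intro j hj
      rw [Finset.mem_range] at hj
      have h1 : (j : ℝ) + 1 ≤ M * ProbabilityTheory.cdf ν t := by
        have : (j : ℝ) + 1 ≤ ⌊M * ProbabilityTheory.cdf ν t⌋₊ := by exact_mod_cast hj
        linarith
      have h2 : (j : ℝ) + 1 ≤ M := by nlinarith
      have hjM : j < M := by exact_mod_cast h2
      rw [Finset.mem_filter, Finset.mem_range]
      refine ⟨hjM, hup j hjM t ?_⟩
      rw [div_le_iff₀ hM0]
      push_cast
      linarith
    have h1 := Finset.card_le_card hsub
    rw [Finset.card_range] at h1
    have h2 : M * ProbabilityTheory.cdf ν t - 1 ≤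
        (((Finset.range M).filter fun j => v j ≤ t).card : ℝ) := by
      have h3 := Nat.lt_floor_add_one (M * ProbabilityTheory.cdf ν t)
      have h4 : (⌊M * ProbabilityTheory.cdf ν t⌋₊ : ℝ) ≤
        (((Finset.range M).filter fun j => v j ≤ t).card : ℝ) := by exact_mod_cast h1
      linarith
    calc ProbabilityTheory.cdf ν t = (M * ProbabilityTheory.cdf ν t - 1) / M + 1 / M := by
          field_simp; ring
      _ ≤ _ := by gcongr

end Quantile

theorem sum_range_mul_div {L : ℕ} (hL : 0 < L) (f : ℕ → ℝ) (M : ℕ) :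
    ∑ l ∈ Finset.range (M * L), f (l / L) = L * ∑ j ∈ Finset.range M, f j := by
  induction M with
  | zero => simp
  | succ M ih =>
    rw [Nat.succ_mul, Finset.sum_range_add, ih, Finset.sum_range_succ, mul_add]
    congr 1
    rw [Finset.sum_congr rfl fun r hr => by
      rw [mul_comm M L, Nat.mul_add_div hL, Nat.div_eq_of_lt (Finset.mem_range.1 hr), add_zero]]
    simp

section FirstStage

variable {Ω : Type*} [MeasurableSpace Ω] [StandardBorelSpace Ω] {μ : Measure Ω}
  [IsProbabilityMeasure μ] {T : Ω → Ω}

omit [IsProbabilityMeasure μ] in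
/-- On a tower there is a set whose visit counts are the integer parts of a given slowly
increasing function. -/
theorem IsTower.exists_visits_eq_floor (hT : MeasurePreserving T μ μ)
    (hinj : Function.Injective T) {N : ℕ} {B : Set Ω} (hB : MeasurableSet B)
    (h : IsTower T N B) {g : ℕ → ℝ} (hg : ∀ i < N, g (i + 1) - g i ∈ Icc (0 : ℝ) 1) :
    ∃ A, MeasurableSet A ∧ ∀ x ∈ B, ∀ i n, i + n ≤ N →
      visits T A n (T^[i] x) = ⌊g (i + n)⌋ - ⌊g i⌋ := by
  obtain ⟨A, hA, hAp, -⟩ := h.exists_prescribed hT hinj hB MeasurableSet.empty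
    (fun _ i => ⌊g (i + 1)⌋ ≠ ⌊g i⌋) fun _ => MeasurableSet.const _
  refine ⟨A, hA, fun x hx i n hn => ?_⟩
  have hind : ∀ l < N, A.indicator (fun _ => (1 : ℝ)) (T^[l] x) = ⌊g (l + 1)⌋ - ⌊g l⌋ := by
    intro l hl
    have h1 := hg l hl
    have h2 : ⌊g l⌋ ≤ ⌊g (l + 1)⌋ := Int.floor_mono (by linarith [h1.1])
    have h3 : ⌊g (l + 1)⌋ ≤ ⌊g l⌋ + 1 := by
      rw [← Int.floor_add_one]
      exact Int.floor_mono (by linarith [h1.2])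
    rcases Classical.em (⌊g (l + 1)⌋ = ⌊g l⌋) with h4 | h4
    · have : T^[l] x ∉ A := fun hm => (hAp x hx l hl).1 hm h4
      rw [indicator_of_notMem this, h4, sub_self]
    · have h5 : ⌊g (l + 1)⌋ = ⌊g l⌋ + 1 := by omega
      rw [indicator_of_mem ((hAp x hx l hl).2 h4), h5]
      push_cast
      ring
  rw [visits, Finset.sum_congr rfl fun r hr => by
    rw [← Function.iterate_add_apply, add_comm r i,
      hind (i + r) (by have := Finset.mem_range.1 hr; omega)]]
  exact Finset.sum_range_sub (fun r => (⌊g (i + r)⌋ : ℝ)) n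

/-- The block of levels `l, …, l + r - 1` of a tower. -/
def levelBlock (T : Ω → Ω) (B : Set Ω) (l r : ℕ) : Set Ω :=
  ⋃ i ∈ Finset.range r, T^[l + i] '' B

omit [MeasurableSpace Ω] [StandardBorelSpace Ω] in
theorem mem_levelBlock {B : Set Ω} {l r : ℕ} {y : Ω} :
    y ∈ levelBlock T B l r ↔ ∃ i < r, ∃ x ∈ B, T^[l + i] x = y := by
  simp [levelBlock]

theorem measurableSet_levelBlock (hT : Measurable T) (hinj : Function.Injective T) {B : Set Ω}
    (hB : MeasurableSet B) (l r : ℕ) : MeasurableSet (levelBlock T B l r) :=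
  Finset.measurableSet_biUnion _ fun _ _ => measurableSet_iterate_image hT hinj _ hB

theorem IsTower.measureReal_levelBlock (hT : MeasurePreserving T μ μ)
    (hinj : Function.Injective T) {N : ℕ} {B : Set Ω} (hB : MeasurableSet B)
    (h : IsTower T N B) {l r : ℕ} (hlr : l + r ≤ N) :
    μ.real (levelBlock T B l r) = r * μ.real B := by
  rw [levelBlock, measureReal_biUnion_finset _ fun i _ =>
    measurableSet_iterate_image hT.measurable hinj _ hB]
  · rw [Finset.sum_congr rfl fun i _ => by
      rw [measureReal_def, measure_iterate_image hT hinj _ hB, ← measureReal_def]]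
    simp
  · intro i hi j hj hij
    rw [Finset.mem_coe, Finset.mem_range] at hi hj
    refine disjoint_left.2 ?_
    rintro _ ⟨x, hx, rfl⟩ ⟨y, hy, hxy⟩
    have := (h (l + j) (by omega) (l + i) (by omega) y hy x hx hxy).1
    omega

/-- A set of measure `1 / q`, negligible along arbitrarily large times, whose law at one time is
close to a prescribed centred law. -/
theorem exists_set_close_law (hT : MeasurePreserving T μ μ) (hTbij : Function.Bijective T)
    (haper : μ {x | ∃ n ≥ 1, T^[n] x = x} = 0) {a : ℕ → ℝ} (ha_pos : ∀ n, 0 < a n)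
    (ha_top : Tendsto a atTop atTop) (ha_small : Tendsto (fun n => a n / n) atTop (𝓝 0))
    {ν : Measure ℝ} [IsProbabilityMeasure ν] (hν_int : Integrable (fun x : ℝ => x) ν)
    (hν_mean : ∫ x, x ∂ν = 0) {ε : ℝ} (hε : 0 < ε) {q : ℕ} (hq : 2 ≤ q) :
    ∃ (A : Set Ω) (n : ℕ), 1 ≤ n ∧ MeasurableSet A ∧ μ.real A = (q : ℝ)⁻¹ ∧
      levyDist (μ.map fun x => (a n)⁻¹ * (visits T A n x - n * (q : ℝ)⁻¹)) ν ≤ ε ∧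
      ∀ δ > 0, ∀ M : ℕ, ∃ n ≥ M,
        μ.real {x | δ * a n < |visits T A n x - n * (q : ℝ)⁻¹|} ≤ δ := by
  obtain ⟨s, hs, hsε⟩ : ∃ s > 0, 5 * s ≤ ε := ⟨ε / 5, by positivity, by linarith⟩
  obtain ⟨M, hM, v, hv0, hνu, hνl⟩ := exists_uniform_approx hν_int hν_mean hs
  set c : ℝ := (q : ℝ)⁻¹ with hc
  have hq0 : (0 : ℝ) < q := by exact_mod_cast (by omega : 0 < q)
  have hc0 : 0 < c := by positivity
  have hc2 : c ≤ 1 / 2 := by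
    rw [hc, one_div]
    exact inv_anti₀ two_pos (by exact_mod_cast hq)
  obtain ⟨n, hn1, hna, hnv⟩ : ∃ n : ℕ, 1 ≤ n ∧ 1 / s ≤ a n ∧
      ∀ j ∈ Finset.range M, |a n / n * v j| < c := by
    have h1 : ∀ᶠ n : ℕ in atTop, ∀ j ∈ Finset.range M, |a n / n * v j| < c := by
      rw [Filter.eventually_all_finset]
      intro j _
      have := (ha_small.mul_const (v j)).abs
      rw [zero_mul, abs_zero] at this
      exact this.eventually_lt_const hc0
    exact ((eventually_ge_atTop 1).and ((ha_top.eventually_ge_atTop _).and h1)).exists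
  have hn0 : (0 : ℝ) < n := by exact_mod_cast hn1
  have han := ha_pos n
  obtain ⟨k, hk⟩ := exists_nat_one_div_lt hs
  set R := n * (k + 1) with hR
  set L := q * R with hL
  have hnL : n ≤ L := by nlinarith [Nat.zero_le (n * k)]
  have hL0 : 0 < L := by omega
  have hLR : (0 : ℝ) < L := by exact_mod_cast hL0
  have hnLs : n / (L : ℝ) ≤ s := by
    refine le_trans ?_ hk.le
    rw [div_le_div_iff₀ hLR (by positivity), one_mul]
    exact_mod_cast (by nlinarith : n * (k + 1) ≤ L)
  obtain ⟨η, hη, hηs, hηθ⟩ : ∃ η > 0, η ≤ s ∧ (1 + 2 * ((M * L : ℕ) : ℝ)) * η < s / (2 * n) := by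
    have h1 : (0 : ℝ) < 1 + 2 * ((M * L : ℕ) : ℝ) := by positivity
    refine ⟨min s (s / (2 * n) / (2 * (1 + 2 * ((M * L : ℕ) : ℝ)))), by positivity,
      min_le_left _ _, ?_⟩
    calc _ ≤ (1 + 2 * ((M * L : ℕ) : ℝ)) * (s / (2 * n) / (2 * (1 + 2 * ((M * L : ℕ) : ℝ)))) := by
          gcongr; exact min_le_right _ _
      _ = s / (2 * n) / 2 := by field_simp
      _ < s / (2 * n) := half_lt_self (by positivity)
  have hML : 1 ≤ M * L := Nat.mul_pos hM hL0
  obtain ⟨B, hB, hBt, hBη⟩ := exists_tower hT hTbij haper hML hη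
  have hinj := hTbij.injective
  let d : ℕ → ℝ := fun j => c + a n / n * v j
  let g : ℕ → ℝ := fun i => ∑ l ∈ Finset.range i, d (l / L)
  have hg1 : ∀ i < M * L, g (i + 1) - g i ∈ Icc (0 : ℝ) 1 := by
    intro i hi
    have h1 := abs_lt.1 (hnv (i / L) (Finset.mem_range.2 (Nat.div_lt_of_lt_mul (by
      rwa [mul_comm] at hi))))
    simp only [g, d, Finset.sum_range_succ, add_sub_cancel_left]
    constructor <;> linarith [h1.1, h1.2]
  obtain ⟨A₁, hA₁, hA₁v⟩ := hBt.exists_visits_eq_floor hT hinj hB hg1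
  have hgN : g (M * L) = ((M * R : ℕ) : ℤ) := by
    have h1 : g (M * L) = L * ∑ j ∈ Finset.range M, d j := sum_range_mul_div hL0 d M
    rw [h1, Finset.sum_add_distrib, ← Finset.mul_sum, hv0, hL, hc]
    simp
    field_simp
  have hg0 : g 0 = 0 := by simp [g]
  have hA₁c : IsAlmostCoboundary μ T c A₁ ((M * L : ℕ) : ℝ) η := by
    refine hBt.isAlmostCoboundary hT hinj hB hBη hA₁ ⟨hc0.le, by linarith⟩ fun x hx => ?_
    have h1 := hA₁v x hx 0 (M * L) (by omega)
    rw [zero_add, hgN, Int.floor_intCast, hg0, Int.floor_zero] at h1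
    rw [show x = T^[0] x from rfl, h1, hL, hc]
    push_cast
    field_simp
    ring
  obtain ⟨A, hA, hAA₁, hAc, hAlim⟩ := hA₁c.exists_limit hT hTbij haper ha_top (by omega) hηθ
  refine ⟨A, n, hn1, hA, hAc, ?_, hAlim⟩
  have hw : 1 - M * (((L - n : ℕ) : ℝ) * μ.real B) ≤ 2 * s := by
    have h1 := hBt.measure_tower hT hinj hB
    have h2 := probReal_compl_eq_one_sub (μ := μ)
      (measurableSet_tower hT.measurable hinj (M * L) hB)
    have h3 := hBt.mul_measure_le_one hT hinj hB
    rw [Nat.cast_sub hnL]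
    push_cast at h1 h3
    have h4 : (M : ℝ) * n * μ.real B = (n / L) * (M * L * μ.real B) := by field_simp
    have h5 : (n / L : ℝ) * (M * L * μ.real B) ≤ n / L * 1 := by gcongr
    rw [h1] at h2
    linarith
  have hZ : μ.real {x | ∃ i < n, T^[i] x ∈ symmDiff A₁ A} ≤ s := by
    refine (measureReal_exists_iterate_mem_le hT (hA₁.symmDiff hA) n).trans ?_
    calc (n : ℝ) * μ.real (symmDiff A₁ A) ≤ n * (2 * (s / (2 * n))) := by gcongr
      _ = s := by field_simp
  refine levyDist_map_le_of_cells
    (((measurable_visits hT.measurable hA n).sub_const _).const_mul _) hM hε hs.le hνu hνl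
    (C := fun j => levelBlock T B (j * L) (L - n))
    (fun j => measurableSet_levelBlock hT.measurable hinj hB _ _) ?_
    (fun j hj => hBt.measureReal_levelBlock hT hinj hB ?_) hw hZ ?_ (by linarith)
  · intro i hi j hj hij
    rw [Finset.mem_coe, Finset.mem_range] at hi hj
    refine disjoint_left.2 fun y hy hy' => ?_
    obtain ⟨r, hr, x, hx, rfl⟩ := mem_levelBlock.1 hy
    obtain ⟨r', hr', x', hx', hxx'⟩ := mem_levelBlock.1 hy'
    have hi' : (i + 1) * L ≤ M * L := Nat.mul_le_mul_right _ hi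
    have hj' : (j + 1) * L ≤ M * L := Nat.mul_le_mul_right _ hj
    rw [Nat.succ_mul] at hi' hj'
    have h1 := (hBt _ (by omega) _ (by omega) x' hx' x hx hxx').1
    have h2 : (i * L + r) / L = i := by
      rw [mul_comm, Nat.mul_add_div hL0, Nat.div_eq_of_lt (by omega), add_zero]
    have h3 : (j * L + r') / L = j := by
      rw [mul_comm, Nat.mul_add_div hL0, Nat.div_eq_of_lt (by omega), add_zero]
    rw [h1, h2] at h3
    exact hij h3
  · have : (j + 1) * L ≤ M * L := Nat.mul_le_mul_right _ hj
    rw [Nat.succ_mul] at this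
    omega
  · intro j hj y hy hyZ
    obtain ⟨r, hr, x, hx, rfl⟩ := mem_levelBlock.1 hy
    have hjL : (j + 1) * L ≤ M * L := Nat.mul_le_mul_right _ hj
    rw [Nat.succ_mul] at hjL
    have h1 := hA₁v x hx (j * L + r) n (by omega)
    rw [visits_congr fun i hi hmem => hyZ ⟨i, hi, hmem⟩] at h1
    have h2 : g (j * L + r + n) - g (j * L + r) = n * c + a n * v j := by
      have h3 : ∀ t ∈ Finset.range n, d ((j * L + r + t) / L) = d j := by
        intro t ht
        have := Finset.mem_range.1 ht
        rw [add_assoc, mul_comm, Nat.mul_add_div hL0, Nat.div_eq_of_lt (by omega), add_zero]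
      simp only [g]
      rw [Finset.sum_range_add, add_sub_cancel_left, Finset.sum_congr rfl h3]
      simp only [d, Finset.sum_const, Finset.card_range, nsmul_eq_mul]
      field_simp
    rw [h1]
    have h4 := Int.floor_le (g (j * L + r + n))
    have h5 := Int.lt_floor_add_one (g (j * L + r + n))
    have h6 := Int.floor_le (g (j * L + r))
    have h7 := Int.lt_floor_add_one (g (j * L + r))
    have h8 : |(⌊g (j * L + r + n)⌋ - ⌊g (j * L + r)⌋ : ℝ) - n * c - a n * v j| ≤ 1 := by
      rw [abs_le]
      constructor <;> linarith
    have h9 : (a n)⁻¹ * ((⌊g (j * L + r + n)⌋ - ⌊g (j * L + r)⌋ : ℝ) - n * c) - v j =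
        (a n)⁻¹ * ((⌊g (j * L + r + n)⌋ - ⌊g (j * L + r)⌋ : ℝ) - n * c - a n * v j) := by
      field_simp
    rw [h9, abs_mul, abs_of_pos (inv_pos.2 han)]
    calc _ ≤ (a n)⁻¹ * 1 := by gcongr
      _ ≤ s := by
        rw [mul_one]
        exact inv_le_of_inv_le₀ hs (by rwa [one_div] at hna)

end FirstStage

/-- in an aperiodic system, given a zero-mean probability measure `ν`,
`ε > 0` and arbitrary positive tolerances `δs k` (`k ≥ 2`), there are a set `A` with
`μ A ≤ ε` and a strictly increasing sequence of positive integers `n k` such that the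
law of the normalized partial sum at time `n 1` is `ε`-close to `ν` and at each time
`n k`, `k ≥ 2`, is `δs k`-close to `δ₀`, in the Lévy metric. -/
theorem exists_set_full_sequence
    {Ω : Type*} [MeasurableSpace Ω] [StandardBorelSpace Ω]
    (μ : Measure Ω) [IsProbabilityMeasure μ]
    (T : Ω → Ω) (hT : MeasurePreserving T μ μ) (hTbij : Function.Bijective T)
    (haper : μ {x | ∃ n ≥ 1, T^[n] x = x} = 0)
    (a : ℕ → ℝ) (ha_pos : ∀ n, 0 < a n) (ha_mono : Monotone a)
    (ha_top : Tendsto a atTop atTop)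
    (ha_small : Tendsto (fun n => a n / n) atTop (𝓝 0))
    (ν : Measure ℝ) [IsProbabilityMeasure ν]
    (hν_int : Integrable (fun x : ℝ => x) ν) (hν_mean : ∫ x, x ∂ν = 0)
    (ε : ℝ) (hε : 0 < ε)
    (δs : ℕ → ℝ) (hδs : ∀ k ≥ 2, 0 < δs k) :
    ∃ A : Set Ω, ∃ n : ℕ → ℕ, MeasurableSet A ∧
      1 ≤ n 1 ∧ (∀ k ≥ 1, n k < n (k + 1)) ∧
      μ A ≤ ENNReal.ofReal ε ∧
      levyDist
        (μ.map (fun x => (a (n 1))⁻¹ *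
          ∑ i ∈ Finset.range (n 1),
            (A.indicator (fun _ => (1 : ℝ)) (T^[i] x) - (μ A).toReal)))
        ν ≤ ε ∧
      ∀ k ≥ 2,
        levyDist
          (μ.map (fun x => (a (n k))⁻¹ *
            ∑ i ∈ Finset.range (n k),
              (A.indicator (fun _ => (1 : ℝ)) (T^[i] x) - (μ A).toReal)))
          (Measure.dirac 0) ≤ δs k := by
  obtain ⟨q, hq⟩ := exists_nat_ge (max 2 ε⁻¹)
  have hq2 : 2 ≤ q := by exact_mod_cast (le_max_left _ _).trans hq
  have hqε : (q : ℝ)⁻¹ ≤ ε := inv_le_of_inv_le₀ hε ((le_max_right _ _).trans hq)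
  obtain ⟨A, n₁, hn₁, hA, hAc, hlevy, hlim⟩ := exists_set_close_law hT hTbij haper ha_pos ha_top
    ha_small hν_int hν_mean hε hq2
  have hY : ∀ n, (fun x => (a n)⁻¹ * ∑ i ∈ Finset.range n,
      (A.indicator (fun _ => (1 : ℝ)) (T^[i] x) - (μ A).toReal)) =
      fun x => (a n)⁻¹ * (visits T A n x - n * (q : ℝ)⁻¹) := by
    intro n
    funext x
    rw [← measureReal_def, hAc, Finset.sum_sub_distrib, visits]
    simp
  have hstep : ∀ k m : ℕ, ∃ n > m, 2 ≤ k →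
      levyDist (μ.map fun x => (a n)⁻¹ * (visits T A n x - n * (q : ℝ)⁻¹)) (Measure.dirac 0) ≤
        δs k := by
    intro k m
    rcases Nat.lt_or_ge k 2 with hk | hk
    · exact ⟨m + 1, Nat.lt_succ_self m, fun h => absurd h (not_le.2 hk)⟩
    obtain ⟨n, hn, hnδ⟩ := hlim (δs k) (hδs k hk) (m + 1)
    refine ⟨n, hn, fun _ => levyDist_map_dirac_le
      (((measurable_visits hT.measurable hA n).sub_const _).const_mul _) (hδs k hk) ?_⟩
    convert hnδ using 4 with x
    rw [abs_mul, abs_of_pos (inv_pos.2 (ha_pos n)), ← div_eq_inv_mul, lt_div_iff₀ (ha_pos n)]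
  choose next hnext hnextδ using hstep
  let n : ℕ → ℕ := fun k => Nat.rec n₁ (fun i m => next (i + 2) m) (k - 1)
  have hsucc : ∀ k, n (k + 2) = next (k + 2) (n (k + 1)) := fun k => rfl
  refine ⟨A, n, hA, hn₁, fun k hk => ?_, ?_, ?_, fun k hk => ?_⟩
  · obtain ⟨k, rfl⟩ := Nat.exists_eq_add_of_le' hk
    rw [hsucc]
    exact hnext _ _
  · rw [← ofReal_measureReal, hAc]
    exact ENNReal.ofReal_le_ofReal hqε
  · rw [hY]
    exact hlevy
  · obtain ⟨k, rfl⟩ := Nat.exists_eq_add_of_le' hk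
    rw [hY, hsucc]
    exact hnextδ _ _ hk
end
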